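/- Suppose n > m(1 − 1/k), p > 0 and p > 1 − m/n. If conditions (1.4) and (1.5) hold and ∫_0^1 f(r) r^{−1−γ} dr = ∞, where γ = (n p + m/k)/(n − (1 − 1/k) m), then every global weak solution u of the problem ∂_t^k u − Σ_{|α|=m} ∂^α a_α(x,t,u) ≥ f(|u|) in ℝ^{n+1}_+ with initial data ∂_t^i u(·,0) = u_i (0 ≤ i ≤ k−1) is trivial, i.e. u = 0 almost everywhere in ℝ^{n+1}_+. -/

import Mathlib

open MeasureTheory Real Set Filter

noncomputable section

/-- The spatial domain `ℝⁿ`. -/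
abbrev Spc (n : ℕ) := EuclideanSpace ℝ (Fin n)

/-- The open ball `B_r` in `ℝⁿ` of radius `r` centered at `0`. -/
def ball0 (n : ℕ) (r : ℝ) : Set (Spc n) := Metric.ball 0 r

/-- The cylinder `Q_r^κ = B_r × (0, r^κ)`. -/
def cyl (n : ℕ) (r κ : ℝ) : Set (Spc n × ℝ) := ball0 n r ×ˢ Ioo 0 (r ^ κ)

/-- The half-space `ℝ^{n+1}_+ = ℝⁿ × (0, ∞)`. -/
def halfSp (n : ℕ) : Set (Spc n × ℝ) := {z | 0 < z.2}

/-- The (finite) set of multi-indices `α` with `|α| = m`. -/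
def mIdx (n m : ℕ) : Finset (Fin n → ℕ) :=
  (Fintype.piFinset fun _ : Fin n => Finset.range (m + 1)).filter fun α => ∑ i, α i = m

/-- Spatial partial derivative `∂/∂x_i`. -/
def spDeriv (n : ℕ) (i : Fin n) (φ : Spc n × ℝ → ℝ) : Spc n × ℝ → ℝ :=
  fun z => deriv (fun s : ℝ => φ (z.1 + s • EuclideanSpace.single i (1 : ℝ), z.2)) 0

/-- Time derivative `∂/∂t`. -/
def tDeriv (n : ℕ) (φ : Spc n × ℝ → ℝ) : Spc n × ℝ → ℝ :=
  fun z => deriv (fun s : ℝ => φ (z.1, s)) z.2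

/-- Multi-index spatial derivative `∂^α`. -/
def mDeriv (n : ℕ) (α : Fin n → ℕ) (φ : Spc n × ℝ → ℝ) : Spc n × ℝ → ℝ :=
  (List.finRange n).foldr (fun i ψ => (spDeriv n i)^[α i] ψ) φ

/-- Caratheodory conditions and the growth bound `|a_α(x,t,ζ)| ≤ A |ζ|^p` for the
coefficients of the operator `L`. -/
def GoodCoeffs (n m : ℕ) (A p : ℝ) (a : (Fin n → ℕ) → Spc n × ℝ → ℝ → ℝ) : Prop :=
  ∀ α ∈ mIdx n m,
    (∀ ζ : ℝ, Measurable fun z => a α z ζ) ∧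
    (∀ᵐ z ∂(volume.restrict (halfSp n)), Continuous fun ζ => a α z ζ) ∧
    (∀ᵐ z ∂(volume.restrict (halfSp n)), ∀ ζ : ℝ, |a α z ζ| ≤ A * |ζ| ^ p)

/-- The standing conditions on `f`: `ζ ↦ f ζ` and `ζ ↦ f (ζ^{1/p})` are nondecreasing
and convex on `[0,∞)`, and `f` is positive on `(0,∞)`. -/
def GoodF (p : ℝ) (f : ℝ → ℝ) : Prop :=
  MonotoneOn f (Ici 0) ∧ ConvexOn ℝ (Ici 0) f ∧
  MonotoneOn (fun ζ => f (ζ ^ (1 / p))) (Ici 0) ∧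
  ConvexOn ℝ (Ici 0) (fun ζ => f (ζ ^ (1 / p))) ∧
  ∀ ζ : ℝ, 0 < ζ → 0 < f ζ

/-- Condition (1.4): `∫_1^∞ ζ^{1/k - 1} f(ζ)^{-1/k} dζ < ∞`. -/
def Cond14 (k : ℕ) (f : ℝ → ℝ) : Prop :=
  IntegrableOn (fun ζ : ℝ => ζ ^ ((k : ℝ)⁻¹ - 1) / f ζ ^ ((k : ℝ)⁻¹)) (Ioi 1)

/-- Condition (1.5): `∫_1^∞ ζ^{p/m - 1} f(ζ)^{-1/m} dζ < ∞`. -/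
def Cond15 (m : ℕ) (p : ℝ) (f : ℝ → ℝ) : Prop :=
  IntegrableOn (fun ζ : ℝ => ζ ^ (p / (m : ℝ) - 1) / f ζ ^ ((m : ℝ)⁻¹)) (Ioi 1)

/-- `v ∈ L^1_loc(ℝⁿ)`. -/
def L1locInit (n : ℕ) (v : Spc n → ℝ) : Prop :=
  ∀ r : ℝ, 0 < r → IntegrableOn v (ball0 n r)

/-- `u` is a global weak solution of
`∂_t^k u - Σ_{|α| = m} ∂^α a_α(x,t,u) ≥ f(|u|)` in `ℝ^{n+1}_+`, with initial data
`∂_t^i u(·,0) = u0 i` for `0 ≤ i ≤ k-1`. -/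
def IsGlobalWeakSol (n k m : ℕ) (p : ℝ) (a : (Fin n → ℕ) → Spc n × ℝ → ℝ → ℝ)
    (f : ℝ → ℝ) (u0 : ℕ → Spc n → ℝ) (u : Spc n × ℝ → ℝ) : Prop :=
  (∀ r : ℝ, 0 < r → IntegrableOn u (cyl n r 1)) ∧
  (∀ r : ℝ, 0 < r → IntegrableOn (fun z => |u z| ^ p) (cyl n r 1)) ∧
  (∀ r : ℝ, 0 < r → IntegrableOn (fun z => f |u z|) (cyl n r 1)) ∧
  ∀ φ : Spc n × ℝ → ℝ, ContDiff ℝ (⊤ : ℕ∞) φ → HasCompactSupport φ →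
    (∀ z, 0 ≤ φ z) →
    (∫ z in halfSp n, (-1 : ℝ) ^ k * u z * (tDeriv n)^[k] φ z)
      - (∫ z in halfSp n, ∑ α ∈ mIdx n m, (-1 : ℝ) ^ m * a α z (u z) * mDeriv n α φ z)
    ≥ (∫ x : Spc n, ∑ i ∈ Finset.range k,
          (-1 : ℝ) ^ i * u0 (k - 1 - i) x * (tDeriv n)^[i] φ (x, 0))
      + ∫ z in halfSp n, f |u z| * φ z

/-- `u = 0` almost everywhere in `ℝ^{n+1}_+`. -/
def TrivialSol (n : ℕ) (u : Spc n × ℝ → ℝ) : Prop :=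
  ∀ᵐ z ∂(volume.restrict (halfSp n)), u z = 0

/-- A smooth plateau function: it equals `1` on `[-(b - δ), a - δ]` and vanishes outside
`(-b, a)`. -/
def plateau (a b δ : ℝ) (s : ℝ) : ℝ :=
  smoothTransition ((a - s) / δ) + smoothTransition ((b + s) / δ) - 1

lemma contDiff_plateau (a b δ : ℝ) : ContDiff ℝ (⊤ : ℕ∞) (plateau a b δ) := by
  unfold plateau
  refine ContDiff.sub (ContDiff.add ?_ ?_) contDiff_const
  · exact smoothTransition.contDiff.comp ((contDiff_const.sub contDiff_id).div_const δ)
  · exact smoothTransition.contDiff.comp ((contDiff_const.add contDiff_id).div_const δ)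

section plateau

variable {a b δ s : ℝ}

lemma plateau_cases (hδ : 0 < δ) (hab : 2 * δ ≤ a + b) (s : ℝ) :
    plateau a b δ s = smoothTransition ((a - s) / δ) ∨
      plateau a b δ s = smoothTransition ((b + s) / δ) := by
  rcases le_total s (a - δ) with h | h
  · right
    have : smoothTransition ((a - s) / δ) = 1 :=
      smoothTransition.one_of_one_le (by rw [one_le_div hδ]; linarith)
    simp [plateau, this]
  · left
    have : smoothTransition ((b + s) / δ) = 1 :=
      smoothTransition.one_of_one_le (by rw [one_le_div hδ]; linarith)
    simp [plateau, this]

lemma plateau_nonneg (hδ : 0 < δ) (hab : 2 * δ ≤ a + b) (s : ℝ) : 0 ≤ plateau a b δ s := by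
  rcases plateau_cases hδ hab s with h | h <;> rw [h] <;> exact smoothTransition.nonneg _

lemma plateau_le_one (hδ : 0 < δ) (hab : 2 * δ ≤ a + b) (s : ℝ) : plateau a b δ s ≤ 1 := by
  rcases plateau_cases hδ hab s with h | h <;> rw [h] <;> exact smoothTransition.le_one _

lemma plateau_eq_one (hδ : 0 < δ) (h₁ : -(b - δ) ≤ s) (h₂ : s ≤ a - δ) :
    plateau a b δ s = 1 := by
  have e₁ : smoothTransition ((a - s) / δ) = 1 :=
    smoothTransition.one_of_one_le (by rw [one_le_div hδ]; linarith)
  have e₂ : smoothTransition ((b + s) / δ) = 1 :=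
    smoothTransition.one_of_one_le (by rw [one_le_div hδ]; linarith)
  simp [plateau, e₁, e₂]

lemma plateau_eq_zero (hδ : 0 < δ) (hab : 2 * δ ≤ a + b) (h : s ≤ -b ∨ a ≤ s) :
    plateau a b δ s = 0 := by
  rcases h with h | h
  · have e₁ : smoothTransition ((a - s) / δ) = 1 :=
      smoothTransition.one_of_one_le (by rw [one_le_div hδ]; linarith)
    have e₂ : smoothTransition ((b + s) / δ) = 0 :=
      smoothTransition.zero_of_nonpos (div_nonpos_of_nonpos_of_nonneg (by linarith) hδ.le)
    simp [plateau, e₁, e₂]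
  · have e₁ : smoothTransition ((a - s) / δ) = 0 :=
      smoothTransition.zero_of_nonpos (div_nonpos_of_nonpos_of_nonneg (by linarith) hδ.le)
    have e₂ : smoothTransition ((b + s) / δ) = 1 :=
      smoothTransition.one_of_one_le (by rw [one_le_div hδ]; linarith)
    simp [plateau, e₁, e₂]

end plateau

lemma continuous_iterate_deriv {g : ℝ → ℝ} (hg : ContDiff ℝ (⊤ : ℕ∞) g) (j : ℕ) :
    Continuous (deriv^[j] g) := by
  rw [← iteratedDeriv_eq_iterate]
  exact hg.continuous_iteratedDeriv j (by exact_mod_cast le_top)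

lemma iterate_deriv_eq_zero_of_const {g : ℝ → ℝ} {c : ℝ} {U : Set ℝ} (hU : IsOpen U)
    (hg : ∀ x ∈ U, g x = c) {j : ℕ} (hj : 1 ≤ j) : ∀ x ∈ U, deriv^[j] g x = 0 := by
  have key : ∀ (i : ℕ), ∀ x ∈ U, deriv^[i + 1] g x = 0 := by
    intro i
    induction i with
    | zero =>
      intro x hx
      have : g =ᶠ[nhds x] fun _ => c := by
        filter_upwards [hU.mem_nhds hx] with y hy using hg y hy
      simp [this.deriv_eq]
    | succ i ih =>
      intro x hx
      rw [Function.iterate_succ_apply']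
      have : deriv^[i + 1] g =ᶠ[nhds x] fun _ => 0 := by
        filter_upwards [hU.mem_nhds hx] with y hy using ih y hy
      rw [this.deriv_eq, deriv_const]
  obtain ⟨i, rfl⟩ := Nat.exists_eq_add_of_le' hj
  exact key i

lemma iterate_deriv_smoothTransition_eq_zero {j : ℕ} (hj : 1 ≤ j) {x : ℝ} (hx : x ≤ 0 ∨ 1 ≤ x) :
    deriv^[j] smoothTransition x = 0 := by
  have hc := continuous_iterate_deriv (smoothTransition.contDiff (n := (⊤ : ℕ∞))) j
  have h₀ : EqOn (deriv^[j] smoothTransition) (fun _ => 0) (Iio 0) :=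
    iterate_deriv_eq_zero_of_const isOpen_Iio
      (fun x hx => smoothTransition.zero_of_nonpos (le_of_lt hx)) hj
  have h₁ : EqOn (deriv^[j] smoothTransition) (fun _ => 0) (Ioi 1) :=
    iterate_deriv_eq_zero_of_const isOpen_Ioi
      (fun x hx => smoothTransition.one_of_one_le (le_of_lt hx)) hj
  rcases hx with hx | hx
  · exact (h₀.closure hc continuous_const) (by simpa using hx)
  · exact (h₁.closure hc continuous_const) (by simpa using hx)

lemma exists_bound_iterate_deriv_smoothTransition (j : ℕ) :
    ∃ C : ℝ, ∀ x, |deriv^[j] smoothTransition x| ≤ C := by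
  rcases Nat.eq_zero_or_pos j with rfl | hj
  · exact ⟨1, fun x => by
      simpa [abs_of_nonneg (smoothTransition.nonneg x)] using smoothTransition.le_one x⟩
  · have hc := continuous_iterate_deriv (smoothTransition.contDiff (n := (⊤ : ℕ∞))) j
    obtain ⟨C, hC⟩ := (isCompact_Icc (a := (0 : ℝ)) (b := 1)).exists_bound_of_continuousOn
      hc.continuousOn
    refine ⟨C, fun x => ?_⟩
    by_cases hx : x ∈ Icc (0 : ℝ) 1
    · exact hC x hx
    · rw [iterate_deriv_smoothTransition_eq_zero hj, abs_zero]
      · exact (norm_nonneg _).trans (hC 0 (by simp))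
      · rw [mem_Icc, not_and_or, not_le, not_le] at hx
        exact hx.imp le_of_lt le_of_lt

lemma iterate_deriv_plateau (a b : ℝ) {δ : ℝ} {j : ℕ} (hj : 1 ≤ j) (s : ℝ) :
    deriv^[j] (plateau a b δ) s = (-1 / δ) ^ j * deriv^[j] smoothTransition ((a - s) / δ) +
      (1 / δ) ^ j * deriv^[j] smoothTransition ((b + s) / δ) := by
  have hd : ∀ i, Differentiable ℝ (deriv^[i] smoothTransition) := fun i => by
    rw [← iteratedDeriv_eq_iterate]
    exact (smoothTransition.contDiff (n := (⊤ : ℕ∞))).differentiable_iteratedDeriv i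
      (by exact_mod_cast ENat.natCast_lt_top i)
  have step : ∀ (i : ℕ) (c d e : ℝ) (s : ℝ), HasDerivAt (fun s => c * (deriv^[i] smoothTransition
      ((d + e * s) / δ))) (c * (e / δ) * deriv^[i + 1] smoothTransition ((d + e * s) / δ)) s := by
    intro i c d e s
    have h₁ : HasDerivAt (fun s : ℝ => (d + e * s) / δ) (e / δ) s := by
      simpa using (((hasDerivAt_id s).const_mul e).const_add d).div_const δ
    have h₂ := (hd i ((d + e * s) / δ)).hasDerivAt
    rw [Function.iterate_succ_apply']
    exact ((h₂.comp s h₁).const_mul c).congr_deriv (by ring)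
  have key : ∀ i : ℕ, deriv^[i + 1] (plateau a b δ) = fun s =>
      (-1 / δ) ^ (i + 1) * deriv^[i + 1] smoothTransition ((a + (-1) * s) / δ) +
      (1 / δ) ^ (i + 1) * deriv^[i + 1] smoothTransition ((b + 1 * s) / δ) := by
    intro i
    induction i with
    | zero =>
      ext s
      have := ((step 0 1 a (-1) s).add (step 0 1 b 1 s)).sub_const 1
      rw [Function.iterate_succ_apply', Function.iterate_zero_apply]
      convert this.deriv using 1
      · congr 1
        ext s
        simp [plateau, sub_eq_add_neg]
      · simp
    | succ i ih =>
      ext s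
      rw [Function.iterate_succ_apply', ih]
      have := (step (i + 1) ((-1 / δ) ^ (i + 1)) a (-1) s).add
        (step (i + 1) ((1 / δ) ^ (i + 1)) b 1 s)
      rw [pow_succ (-1 / δ) (i + 1), pow_succ (1 / δ) (i + 1)]
      exact this.deriv
  obtain ⟨i, rfl⟩ := Nat.exists_eq_add_of_le' hj
  rw [key i]
  simp [sub_eq_add_neg]

lemma iterate_deriv_plateau_eq_zero {a b δ s : ℝ} (hδ : 0 < δ) (hab : 2 * δ ≤ a + b) {j : ℕ}
    (hj : 1 ≤ j) (hs : s ≤ -b ∨ a ≤ s ∨ (-(b - δ) ≤ s ∧ s ≤ a - δ)) :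
    deriv^[j] (plateau a b δ) s = 0 := by
  rw [iterate_deriv_plateau a b hj, iterate_deriv_smoothTransition_eq_zero hj,
    iterate_deriv_smoothTransition_eq_zero hj, mul_zero, mul_zero, add_zero]
  · rcases hs with hs | hs | hs
    · exact Or.inl (div_nonpos_of_nonpos_of_nonneg (by linarith) hδ.le)
    · right; rw [one_le_div hδ]; linarith
    · right; rw [one_le_div hδ]; linarith [hs.1]
  · rcases hs with hs | hs | hs
    · right; rw [one_le_div hδ]; linarith
    · exact Or.inl (div_nonpos_of_nonpos_of_nonneg (by linarith) hδ.le)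
    · right; rw [one_le_div hδ]; linarith [hs.2]

lemma exists_bound_iterate_deriv_plateau (N : ℕ) :
    ∃ C : ℝ, 1 ≤ C ∧ ∀ j ≤ N, ∀ a b δ : ℝ, 0 < δ → 2 * δ ≤ a + b → ∀ s,
      |deriv^[j] (plateau a b δ) s| ≤ C * (1 / δ) ^ j := by
  choose C hC using exists_bound_iterate_deriv_smoothTransition
  have hC0 : ∀ j, 0 ≤ C j := fun j => (abs_nonneg _).trans (hC j 0)
  refine ⟨1 + 2 * ∑ j ∈ Finset.range (N + 1), C j, ?_, ?_⟩
  · linarith [Finset.sum_nonneg (s := Finset.range (N + 1)) (fun j _ => hC0 j)]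
  intro j hj a b δ hδ hab s
  have hle : C j ≤ ∑ j ∈ Finset.range (N + 1), C j :=
    Finset.single_le_sum (f := C) (fun j _ => hC0 j) (by simpa [Nat.lt_succ_iff] using hj)
  rcases Nat.eq_zero_or_pos j with rfl | hj'
  · simp only [Function.iterate_zero_apply, pow_zero, mul_one]
    rw [abs_of_nonneg (plateau_nonneg hδ hab s)]
    linarith [plateau_le_one hδ hab s, hC0 0]
  · rw [iterate_deriv_plateau a b hj']
    have hp : 0 ≤ (1 / δ) ^ j := by positivity
    calc _ ≤ (1 / δ) ^ j * C j + (1 / δ) ^ j * C j := by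
          refine (abs_add_le _ _).trans (add_le_add ?_ ?_)
          · rw [abs_mul, abs_pow, abs_div, abs_neg, abs_one, abs_of_pos hδ]
            exact mul_le_mul_of_nonneg_left (hC j _) hp
          · rw [abs_mul, abs_of_nonneg hp]
            exact mul_le_mul_of_nonneg_left (hC j _) hp
      _ ≤ _ := by nlinarith

/-- The function `(x, t) ↦ (∏ i, g i (x i)) * η t` with separated variables. -/
def sepFun (n : ℕ) (g : Fin n → ℝ → ℝ) (η : ℝ → ℝ) : Spc n × ℝ → ℝ :=
  fun z => (∏ i, g i (z.1 i)) * η z.2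

lemma tDeriv_sepFun (n : ℕ) (g : Fin n → ℝ → ℝ) (η : ℝ → ℝ) :
    tDeriv n (sepFun n g η) = sepFun n g (deriv η) := by
  ext z
  simp [tDeriv, sepFun, deriv_const_mul_field]

lemma iterate_tDeriv_sepFun (n : ℕ) (g : Fin n → ℝ → ℝ) (η : ℝ → ℝ) (j : ℕ) :
    (tDeriv n)^[j] (sepFun n g η) = sepFun n g (deriv^[j] η) := by
  induction j with
  | zero => rfl
  | succ j ih => rw [Function.iterate_succ_apply', ih, tDeriv_sepFun, Function.iterate_succ_apply']

lemma spDeriv_sepFun (n : ℕ) (i : Fin n) (g : Fin n → ℝ → ℝ) (η : ℝ → ℝ) :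
    spDeriv n i (sepFun n g η) = sepFun n (Function.update g i (deriv (g i))) η := by
  ext z
  have h₁ : ∀ s : ℝ, sepFun n g η (z.1 + s • EuclideanSpace.single i (1 : ℝ), z.2)
      = ((∏ j ∈ Finset.univ.erase i, g j (z.1 j)) * η z.2) * g i (z.1 i + s) := by
    intro s
    simp only [sepFun]
    rw [← Finset.mul_prod_erase Finset.univ _ (Finset.mem_univ i)]
    have : ∏ j ∈ Finset.univ.erase i, g j ((z.1 + s • EuclideanSpace.single i (1 : ℝ)) j)
        = ∏ j ∈ Finset.univ.erase i, g j (z.1 j) := by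
      refine Finset.prod_congr rfl fun j hj => ?_
      have hji : j ≠ i := Finset.ne_of_mem_erase hj
      simp [hji]
    rw [this]
    simp
    ring
  have h₂ : sepFun n (Function.update g i (deriv (g i))) η z
      = ((∏ j ∈ Finset.univ.erase i, g j (z.1 j)) * η z.2) * deriv (g i) (z.1 i) := by
    simp only [sepFun]
    rw [← Finset.mul_prod_erase Finset.univ _ (Finset.mem_univ i)]
    have : ∏ j ∈ Finset.univ.erase i, Function.update g i (deriv (g i)) j (z.1 j)
        = ∏ j ∈ Finset.univ.erase i, g j (z.1 j) := by
      refine Finset.prod_congr rfl fun j hj => ?_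
      rw [Function.update_of_ne (Finset.ne_of_mem_erase hj)]
    rw [this, Function.update_self]
    ring
  simp only [spDeriv, h₁, h₂]
  rw [deriv_const_mul_field, deriv_comp_const_add, add_zero]

lemma iterate_spDeriv_sepFun (n : ℕ) (i : Fin n) (g : Fin n → ℝ → ℝ) (η : ℝ → ℝ) (j : ℕ) :
    (spDeriv n i)^[j] (sepFun n g η) = sepFun n (Function.update g i (deriv^[j] (g i))) η := by
  induction j with
  | zero => simp
  | succ j ih =>
    rw [Function.iterate_succ_apply', ih, spDeriv_sepFun, Function.iterate_succ_apply']
    simp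

lemma mDeriv_sepFun (n : ℕ) (α : Fin n → ℕ) (g : Fin n → ℝ → ℝ) (η : ℝ → ℝ) :
    mDeriv n α (sepFun n g η) = sepFun n (fun i => deriv^[α i] (g i)) η := by
  have key : ∀ l : List (Fin n), l.Nodup →
      l.foldr (fun i ψ => (spDeriv n i)^[α i] ψ) (sepFun n g η)
        = sepFun n (fun i => if i ∈ l then deriv^[α i] (g i) else g i) η := by
    intro l
    induction l with
    | nil => intro _; simp
    | cons i l ih =>
      intro hl
      rw [List.nodup_cons] at hl
      rw [List.foldr_cons, ih hl.2, iterate_spDeriv_sepFun]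
      congr 1
      ext j : 1
      by_cases hj : j = i
      · subst hj
        simp [hl.1]
      · simp [hj]
  rw [mDeriv, key _ (List.nodup_finRange n)]
  simp

/-- The box `(-r, r)^n × (0, T)`. -/
def box (n : ℕ) (r T : ℝ) : Set (Spc n × ℝ) := {z | (∀ i, |z.1 i| < r) ∧ 0 < z.2 ∧ z.2 < T}

lemma box_eq_prod (n : ℕ) (r T : ℝ) :
    box n r T = {x : Spc n | ∀ i, |x i| < r} ×ˢ Ioo 0 T := by
  ext z
  simp [box]

lemma setOf_abs_lt_eq_preimage (n : ℕ) (r : ℝ) :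
    {x : Spc n | ∀ i, |x i| < r} =
      (WithLp.ofLp : Spc n → Fin n → ℝ) ⁻¹' (Set.univ.pi fun _ => Ioo (-r) r) := by
  ext x
  simp [abs_lt]

lemma measurableSet_box (n : ℕ) (r T : ℝ) : MeasurableSet (box n r T) := by
  rw [box_eq_prod, setOf_abs_lt_eq_preimage]
  exact ((PiLp.volume_preserving_ofLp (Fin n)).measurable
    (MeasurableSet.univ_pi fun _ => measurableSet_Ioo)).prod measurableSet_Ioo

lemma volume_box (n : ℕ) {r T : ℝ} (hr : 0 < r) :
    volume (box n r T) = ENNReal.ofReal ((2 * r) ^ n * T) := by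
  rw [box_eq_prod, setOf_abs_lt_eq_preimage, Measure.volume_eq_prod, Measure.prod_prod,
    (PiLp.volume_preserving_ofLp (Fin n)).measure_preimage
      (MeasurableSet.univ_pi fun _ => measurableSet_Ioo).nullMeasurableSet,
    volume_pi_pi, ENNReal.ofReal_mul (by positivity), ENNReal.ofReal_pow (by positivity)]
  simp [Real.volume_Ioo, two_mul]

lemma volume_real_box (n : ℕ) {r T : ℝ} (hr : 0 < r) (hT : 0 < T) :
    volume.real (box n r T) = (2 * r) ^ n * T := by
  rw [Measure.real, volume_box n hr, ENNReal.toReal_ofReal (by positivity)]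

lemma box_subset_box (n : ℕ) {r₁ r₂ T₁ T₂ : ℝ} (hr : r₁ ≤ r₂) (hT : T₁ ≤ T₂) :
    box n r₁ T₁ ⊆ box n r₂ T₂ :=
  fun _ hz => ⟨fun i => (hz.1 i).trans_le hr, hz.2.1, hz.2.2.trans_le hT⟩

lemma box_subset_halfSp (n : ℕ) (r T : ℝ) : box n r T ⊆ halfSp n := fun _ hz => hz.2.1

lemma norm_le_of_abs_le (n : ℕ) {r : ℝ} {x : Spc n} (hx : ∀ i, |x i| ≤ r) : ‖x‖ ≤ n * |r| := by
  rw [EuclideanSpace.norm_eq]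
  have h₁ : ∑ i, ‖x i‖ ^ 2 ≤ (∑ i, ‖x i‖) ^ 2 :=
    Finset.sum_sq_le_sq_sum_of_nonneg fun i _ => norm_nonneg _
  have h₂ : ∑ i, ‖x i‖ ≤ n * |r| := by
    calc _ ≤ ∑ _i : Fin n, |r| := Finset.sum_le_sum fun i _ => (hx i).trans (le_abs_self r)
      _ = _ := by simp
  exact (Real.sqrt_le_sqrt h₁).trans
    (by rwa [Real.sqrt_sq (Finset.sum_nonneg fun i _ => norm_nonneg _)])

lemma exists_box_subset_cyl (n : ℕ) (r T : ℝ) : ∃ ρ, 0 < ρ ∧ box n r T ⊆ cyl n ρ 1 := by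
  refine ⟨n * |r| + |T| + 1, by positivity, fun z hz => ⟨?_, hz.2.1, ?_⟩⟩
  · rw [ball0, mem_ball_zero_iff]
    have := norm_le_of_abs_le n (fun i => (hz.1 i).le)
    linarith [abs_nonneg T]
  · rw [rpow_one]
    have : 0 ≤ n * |r| := by positivity
    linarith [le_abs_self T, hz.2.2]

lemma integrableOn_box (n : ℕ) {g : Spc n × ℝ → ℝ}
    (hg : ∀ r : ℝ, 0 < r → IntegrableOn g (cyl n r 1)) (r T : ℝ) : IntegrableOn g (box n r T) := by
  obtain ⟨ρ, hρ, hsub⟩ := exists_box_subset_cyl n r T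
  exact (hg ρ hρ).mono_set hsub

lemma measurableSet_halfSp (n : ℕ) : MeasurableSet (halfSp n) :=
  measurableSet_lt measurable_const measurable_snd

lemma contDiff_sepFun (n : ℕ) {g : Fin n → ℝ → ℝ} {η : ℝ → ℝ}
    (hg : ∀ i, ContDiff ℝ (⊤ : ℕ∞) (g i)) (hη : ContDiff ℝ (⊤ : ℕ∞) η) :
    ContDiff ℝ (⊤ : ℕ∞) (sepFun n g η) := by
  refine ContDiff.mul (contDiff_prod fun i _ => ?_) (hη.comp contDiff_snd)
  exact (hg i).comp
    ((EuclideanSpace.proj i : Spc n →L[ℝ] ℝ).contDiff.comp contDiff_fst)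

/-- The cutoff function of the box of size `(r, T)`, equal to one on the box of size
`(r - δ, T - τ)`. -/
def boxCutoff (n : ℕ) (r δ T τ : ℝ) : Spc n × ℝ → ℝ :=
  sepFun n (fun _ => plateau r r δ) (plateau T (2 * τ) τ)

section boxCutoff

variable {n : ℕ} {r δ T τ : ℝ} {z : Spc n × ℝ}

lemma contDiff_boxCutoff : ContDiff ℝ (⊤ : ℕ∞) (boxCutoff n r δ T τ) :=
  contDiff_sepFun n (fun _ => contDiff_plateau _ _ _) (contDiff_plateau _ _ _)

lemma boxCutoff_nonneg (hδ : 0 < δ) (hr : δ < r) (hτ : 0 < τ) (hT : τ < T) (z : Spc n × ℝ) :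
    0 ≤ boxCutoff n r δ T τ z :=
  mul_nonneg (Finset.prod_nonneg fun _ _ => plateau_nonneg hδ (by linarith) _)
    (plateau_nonneg hτ (by linarith) _)

lemma boxCutoff_le_one (hδ : 0 < δ) (hr : δ < r) (hτ : 0 < τ) (hT : τ < T) (z : Spc n × ℝ) :
    boxCutoff n r δ T τ z ≤ 1 :=
  mul_le_one₀ (Finset.prod_le_one (fun _ _ => plateau_nonneg hδ (by linarith) _)
    fun _ _ => plateau_le_one hδ (by linarith) _)
    (plateau_nonneg hτ (by linarith) _) (plateau_le_one hτ (by linarith) _)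

lemma hasCompactSupport_boxCutoff (hδ : 0 < δ) (hr : δ < r) (hτ : 0 < τ) (hT : τ < T) :
    HasCompactSupport (boxCutoff n r δ T τ) := by
  refine HasCompactSupport.intro
    ((isCompact_closedBall (0 : Spc n) (n * |r|)).prod (isCompact_Icc (a := -(2 * τ)) (b := T)))
    fun z hz => ?_
  simp only [boxCutoff, sepFun]
  by_cases hx : ∀ i, |z.1 i| ≤ r
  · have ht : z.2 ∉ Icc (-(2 * τ)) T := fun ht =>
      hz ⟨mem_closedBall_zero_iff.2 (norm_le_of_abs_le n hx), ht⟩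
    rw [mem_Icc, not_and_or, not_le, not_le] at ht
    rw [plateau_eq_zero hτ (by linarith) (ht.imp le_of_lt le_of_lt), mul_zero]
  · push Not at hx
    obtain ⟨i, hi⟩ := hx
    rw [Finset.prod_eq_zero (Finset.mem_univ i), zero_mul]
    refine plateau_eq_zero hδ (by linarith) ?_
    rcases lt_abs.1 hi with h | h
    · exact Or.inr h.le
    · exact Or.inl (by linarith)

lemma boxCutoff_eq_one (hδ : 0 < δ) (hτ : 0 < τ) (hz : z ∈ box n (r - δ) (T - τ)) :
    boxCutoff n r δ T τ z = 1 := by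
  simp only [boxCutoff, sepFun]
  rw [plateau_eq_one hτ (by linarith [hz.2.1]) hz.2.2.le, mul_one]
  refine Finset.prod_eq_one fun i _ => ?_
  have := abs_lt.1 (hz.1 i)
  exact plateau_eq_one hδ (by linarith) (by linarith)

lemma iterate_deriv_plateau_of_le_abs (hδ : 0 < δ) (hr : δ < r) (j : ℕ) {s : ℝ} (hs : r ≤ |s|) :
    deriv^[j] (plateau r r δ) s = 0 := by
  have h : s ≤ -r ∨ r ≤ s := by
    rcases le_abs.1 hs with h | h
    · exact Or.inr h
    · exact Or.inl (by linarith)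
  rcases Nat.eq_zero_or_pos j with rfl | hj
  · exact plateau_eq_zero hδ (by linarith) h
  · exact iterate_deriv_plateau_eq_zero hδ (by linarith) hj (h.imp id Or.inl)

lemma boxCutoff_eq_zero (hδ : 0 < δ) (hr : δ < r) (hτ : 0 < τ) (hT : τ < T) (hz : z ∈ halfSp n)
    (hz' : z ∉ box n r T) : boxCutoff n r δ T τ z = 0 := by
  simp only [boxCutoff, sepFun]
  by_cases hx : ∀ i, |z.1 i| < r
  · have : T ≤ z.2 := not_lt.1 fun h => hz' ⟨hx, hz, h⟩
    rw [plateau_eq_zero hτ (by linarith) (Or.inr this), mul_zero]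
  · push Not at hx
    obtain ⟨i, hi⟩ := hx
    rw [Finset.prod_eq_zero (Finset.mem_univ i), zero_mul]
    exact iterate_deriv_plateau_of_le_abs hδ hr 0 hi

lemma iterate_tDeriv_boxCutoff_eq_zero (hδ : 0 < δ) (hr : δ < r) (hτ : 0 < τ) (hT : τ < T)
    {k : ℕ} (hk : 1 ≤ k) (hz : z ∈ halfSp n)
    (hz' : z ∉ box n r T \ box n (r - δ) (T - τ)) :
    (tDeriv n)^[k] (boxCutoff n r δ T τ) z = 0 := by
  rw [boxCutoff, iterate_tDeriv_sepFun]
  simp only [sepFun]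
  have hz0 : 0 < z.2 := hz
  by_cases hx : ∀ i, |z.1 i| < r
  · have : T ≤ z.2 ∨ z.2 ≤ T - τ := by
      by_contra! h
      exact hz' ⟨⟨hx, hz, h.1⟩, fun h' => absurd h'.2.2 (by linarith [h.2])⟩
    rw [iterate_deriv_plateau_eq_zero hτ (by linarith) hk
      (Or.inr (this.imp id fun h => ⟨by linarith, h⟩)), mul_zero]
  · push Not at hx
    obtain ⟨i, hi⟩ := hx
    rw [Finset.prod_eq_zero (Finset.mem_univ i), zero_mul]
    exact iterate_deriv_plateau_of_le_abs hδ hr 0 hi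

lemma iterate_tDeriv_boxCutoff_zero (hτ : 0 < τ) (hT : τ < T) {k : ℕ} (hk : 1 ≤ k) (x : Spc n) :
    (tDeriv n)^[k] (boxCutoff n r δ T τ) (x, 0) = 0 := by
  rw [boxCutoff, iterate_tDeriv_sepFun]
  simp only [sepFun]
  rw [iterate_deriv_plateau_eq_zero hτ (by linarith) hk
    (Or.inr (Or.inr ⟨by linarith, by linarith⟩)), mul_zero]

lemma mDeriv_boxCutoff_eq_zero (hδ : 0 < δ) (hr : δ < r) (hτ : 0 < τ) (hT : τ < T)
    {m : ℕ} (hm : 1 ≤ m) {α : Fin n → ℕ} (hα : α ∈ mIdx n m) (hz : z ∈ halfSp n)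
    (hz' : z ∉ box n r T \ box n (r - δ) (T - τ)) :
    mDeriv n α (boxCutoff n r δ T τ) z = 0 := by
  rw [boxCutoff, mDeriv_sepFun]
  simp only [sepFun]
  by_cases hx : ∀ i, |z.1 i| < r
  · by_cases ht : z.2 < T
    · have hin : z ∈ box n (r - δ) (T - τ) := by
        by_contra h
        exact hz' ⟨⟨hx, hz, ht⟩, h⟩
      have hsum : ∑ i, α i = m := (Finset.mem_filter.1 hα).2
      obtain ⟨i, -, hi⟩ : ∃ i ∈ Finset.univ, α i ≠ 0 := by
        by_contra! h
        rw [Finset.sum_eq_zero h] at hsum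
        omega
      have := abs_lt.1 (hin.1 i)
      rw [Finset.prod_eq_zero (Finset.mem_univ i), zero_mul]
      exact iterate_deriv_plateau_eq_zero hδ (by linarith) (Nat.one_le_iff_ne_zero.2 hi)
        (Or.inr (Or.inr ⟨by linarith, by linarith⟩))
    · rw [plateau_eq_zero hτ (by linarith) (Or.inr (not_lt.1 ht)), mul_zero]
  · push Not at hx
    obtain ⟨i, hi⟩ := hx
    rw [Finset.prod_eq_zero (Finset.mem_univ i), zero_mul]
    exact iterate_deriv_plateau_of_le_abs hδ hr (α i) hi

end boxCutoff

lemma exists_bound_deriv_boxCutoff (n k m : ℕ) :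
    ∃ C : ℝ, 1 ≤ C ∧ ∀ r δ T τ : ℝ, 0 < δ → δ < r → 0 < τ → τ < T → ∀ z : Spc n × ℝ,
      |(tDeriv n)^[k] (boxCutoff n r δ T τ) z| ≤ C * (1 / τ) ^ k ∧
      ∀ α ∈ mIdx n m, |mDeriv n α (boxCutoff n r δ T τ) z| ≤ C * (1 / δ) ^ m := by
  obtain ⟨C, hC1, hC⟩ := exists_bound_iterate_deriv_plateau (max k m)
  refine ⟨C ^ (n + 1), one_le_pow₀ hC1, fun r δ T τ hδ hr hτ hT z => ⟨?_, fun α hα => ?_⟩⟩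
  · rw [boxCutoff, iterate_tDeriv_sepFun]
    simp only [sepFun]
    have h₁ : |∏ i, plateau r r δ (z.1 i)| ≤ 1 := by
      rw [Finset.abs_prod]
      refine Finset.prod_le_one (fun _ _ => abs_nonneg _) fun i _ => ?_
      rw [abs_of_nonneg (plateau_nonneg hδ (by linarith) _)]
      exact plateau_le_one hδ (by linarith) _
    rw [abs_mul]
    calc _ ≤ 1 * (C * (1 / τ) ^ k) :=
          mul_le_mul h₁ (hC k (le_max_left _ _) _ _ _ hτ (by linarith) _) (abs_nonneg _) zero_le_one
      _ ≤ C ^ (n + 1) * (1 / τ) ^ k := by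
          rw [one_mul]
          gcongr
          exact le_self_pow₀ hC1 (by omega)
  · rw [boxCutoff, mDeriv_sepFun]
    simp only [sepFun]
    have hsum : ∑ i, α i = m := (Finset.mem_filter.1 hα).2
    have h₂ : |plateau T (2 * τ) τ z.2| ≤ 1 := by
      rw [abs_of_nonneg (plateau_nonneg hτ (by linarith) _)]
      exact plateau_le_one hτ (by linarith) _
    rw [abs_mul, Finset.abs_prod]
    calc _ ≤ (∏ i, C * (1 / δ) ^ α i) * 1 := by
          refine mul_le_mul (Finset.prod_le_prod (fun _ _ => abs_nonneg _) fun i _ => ?_) h₂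
            (abs_nonneg _) (Finset.prod_nonneg fun _ _ => by positivity)
          refine hC _ ?_ _ _ _ hδ (by linarith) _
          exact ((Finset.single_le_sum (f := α) (fun _ _ => Nat.zero_le _)
            (Finset.mem_univ i)).trans hsum.le).trans (le_max_right _ _)
      _ = C ^ n * (1 / δ) ^ m := by
          rw [Finset.prod_mul_distrib, Finset.prod_pow_eq_pow_sum, hsum]
          simp
      _ ≤ C ^ (n + 1) * (1 / δ) ^ m := by
          gcongr
          · exact n.le_succ

/-- An a priori estimate of Caccioppoli type on boxes for global weak solutions. -/
lemma exists_energy_estimate {n k m : ℕ} (hk : 1 ≤ k) (hm : 1 ≤ m) {A p : ℝ} (hA : 0 < A)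
    {a : (Fin n → ℕ) → Spc n × ℝ → ℝ → ℝ} (ha : GoodCoeffs n m A p a) {f : ℝ → ℝ}
    (hf0 : ∀ x, 0 ≤ x → 0 ≤ f x) {u0 : ℕ → Spc n → ℝ}
    (hu0nn : ∀ᵐ x ∂(volume : Measure (Spc n)), 0 ≤ u0 (k - 1) x)
    {u : Spc n × ℝ → ℝ} (hu : IsGlobalWeakSol n k m p a f u0 u) :
    ∃ C : ℝ, 0 < C ∧ ∀ r₁ r₂ T₁ T₂ : ℝ, 0 < r₁ → r₁ < r₂ → 0 < T₁ → T₁ < T₂ →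
      ∫ z in box n r₁ T₁, f |u z| ≤
        C * ((1 / (T₂ - T₁)) ^ k * ∫ z in box n r₂ T₂ \ box n r₁ T₁, |u z|)
        + C * ((1 / (r₂ - r₁)) ^ m * ∫ z in box n r₂ T₂ \ box n r₁ T₁, |u z| ^ p) := by
  obtain ⟨C, hC1, hC⟩ := exists_bound_deriv_boxCutoff n k m
  obtain ⟨hu₁, hup, huf, hweak⟩ := hu
  set N : ℝ := ((mIdx n m).card : ℝ)
  have hN : 0 ≤ N := Nat.cast_nonneg _
  refine ⟨C + N * A * C, by positivity, fun r₁ r₂ T₁ T₂ hr₁ hr hT₁ hT => ?_⟩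
  have hδ : 0 < r₂ - r₁ := by linarith
  have hτ : 0 < T₂ - T₁ := by linarith
  have hδr : r₂ - r₁ < r₂ := by linarith
  have hτT : T₂ - T₁ < T₂ := by linarith
  set φ := boxCutoff n r₂ (r₂ - r₁) T₂ (T₂ - T₁) with hφ
  have e₁ : r₂ - (r₂ - r₁) = r₁ := by ring
  have e₂ : T₂ - (T₂ - T₁) = T₁ := by ring
  set E := box n r₂ T₂ \ box n r₁ T₁ with hE
  have hEm : MeasurableSet E := (measurableSet_box n _ _).diff (measurableSet_box n _ _)
  have hEs : halfSp n ∩ E = E := inter_eq_right.2 (sdiff_subset.trans (box_subset_halfSp n _ _))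
  have hEu : IntegrableOn (fun z => |u z|) E :=
    ((integrableOn_box n hu₁ r₂ T₂).mono_set sdiff_subset).abs
  have hEp : IntegrableOn (fun z => |u z| ^ p) E :=
    (integrableOn_box n hup r₂ T₂).mono_set sdiff_subset
  have hmain := hweak φ contDiff_boxCutoff (hasCompactSupport_boxCutoff hδ hδr hτ hτT)
    (boxCutoff_nonneg hδ hδr hτ hτT)
  have htime : ∫ z in halfSp n, (-1 : ℝ) ^ k * u z * (tDeriv n)^[k] φ z ≤
      C * (1 / (T₂ - T₁)) ^ k * ∫ z in E, |u z| := by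
    have hgint : Integrable (E.indicator fun z => C * (1 / (T₂ - T₁)) ^ k * |u z|)
        (volume.restrict (halfSp n)) :=
      (IntegrableOn.integrable_indicator (hEu.const_mul _) hEm).restrict
    refine (le_abs_self _).trans ?_
    rw [← Real.norm_eq_abs]
    refine (norm_integral_le_of_norm_le hgint ?_).trans ?_
    · filter_upwards [ae_restrict_mem (measurableSet_halfSp n)] with z hz
      by_cases hzE : z ∈ E
      · rw [indicator_of_mem hzE, norm_mul, norm_mul, norm_pow, norm_neg, norm_one, one_pow,
          one_mul, mul_comm]
        exact mul_le_mul_of_nonneg_right (hC _ _ _ _ hδ hδr hτ hτT z).1 (abs_nonneg _)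
      · rw [indicator_of_notMem hzE, iterate_tDeriv_boxCutoff_eq_zero hδ hδr hτ hτT hk hz
          (by rwa [e₁, e₂]), mul_zero, norm_zero]
    · rw [setIntegral_indicator hEm, hEs, integral_const_mul]
  have hspace : -(∫ z in halfSp n, ∑ α ∈ mIdx n m, (-1 : ℝ) ^ m * a α z (u z) * mDeriv n α φ z) ≤
      N * (A * C * (1 / (r₂ - r₁)) ^ m) * ∫ z in E, |u z| ^ p := by
    have hgint : Integrable (E.indicator fun z => N * (A * C * (1 / (r₂ - r₁)) ^ m) * |u z| ^ p)
        (volume.restrict (halfSp n)) :=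
      (IntegrableOn.integrable_indicator (hEp.const_mul _) hEm).restrict
    refine (neg_le_abs _).trans ?_
    rw [← Real.norm_eq_abs]
    refine (norm_integral_le_of_norm_le hgint ?_).trans ?_
    · have hall : ∀ᵐ z ∂(volume.restrict (halfSp n)), ∀ α ∈ mIdx n m, ∀ ζ : ℝ,
          |a α z ζ| ≤ A * |ζ| ^ p :=
        (Finset.eventually_all (mIdx n m)).2 fun α hα => (ha α hα).2.2
      filter_upwards [ae_restrict_mem (measurableSet_halfSp n), hall] with z hz hz'
      by_cases hzE : z ∈ E
      · rw [indicator_of_mem hzE]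
        refine (norm_sum_le _ _).trans ((Finset.sum_le_card_nsmul _ _
          (A * C * (1 / (r₂ - r₁)) ^ m * |u z| ^ p) fun α hα => ?_).trans_eq ?_)
        · rw [norm_mul, norm_mul, norm_pow, norm_neg, norm_one, one_pow, one_mul]
          calc _ ≤ (A * |u z| ^ p) * (C * (1 / (r₂ - r₁)) ^ m) :=
                mul_le_mul (hz' α hα _) ((hC _ _ _ _ hδ hδr hτ hτT z).2 α hα) (abs_nonneg _)
                  (by positivity)
            _ = _ := by ring
        · rw [nsmul_eq_mul]
          ring
      · rw [indicator_of_notMem hzE, Finset.sum_eq_zero, norm_zero]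
        intro α hα
        rw [mDeriv_boxCutoff_eq_zero hδ hδr hτ hτT hm hα hz (by rwa [e₁, e₂]), mul_zero]
    · rw [setIntegral_indicator hEm, hEs, integral_const_mul]
  have hinit : 0 ≤ ∫ x : Spc n, ∑ i ∈ Finset.range k,
      (-1 : ℝ) ^ i * u0 (k - 1 - i) x * (tDeriv n)^[i] φ (x, 0) := by
    refine integral_nonneg_of_ae ?_
    filter_upwards [hu0nn] with x hx
    rw [Finset.sum_eq_single_of_mem 0 (Finset.mem_range.2 hk)]
    · simpa using mul_nonneg hx (boxCutoff_nonneg hδ hδr hτ hτT (x, 0))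
    · intro i _ hi
      rw [iterate_tDeriv_boxCutoff_zero hτ hτT (Nat.one_le_iff_ne_zero.2 hi), mul_zero]
  have hsource : ∫ z in box n r₁ T₁, f |u z| ≤ ∫ z in halfSp n, f |u z| * φ z := by
    have hfb : IntegrableOn (fun z => f |u z|) (box n r₂ T₂) := integrableOn_box n huf r₂ T₂
    have hfφ : IntegrableOn (fun z => f |u z| * φ z) (box n r₂ T₂) := by
      refine hfb.mul_bdd (c := 1) (contDiff_boxCutoff.continuous.aestronglyMeasurable)
        (Eventually.of_forall fun z => ?_)
      rw [Real.norm_eq_abs, abs_of_nonneg (boxCutoff_nonneg hδ hδr hτ hτT z)]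
      exact boxCutoff_le_one hδ hδr hτ hτT z
    have hrest : ∫ z in halfSp n, f |u z| * φ z = ∫ z in box n r₂ T₂, f |u z| * φ z := by
      refine setIntegral_eq_of_subset_of_forall_sdiff_eq_zero (measurableSet_halfSp n)
        (box_subset_halfSp n _ _) fun z hz => ?_
      rw [hφ, boxCutoff_eq_zero hδ hδr hτ hτT hz.1 hz.2, mul_zero]
    rw [hrest]
    calc ∫ z in box n r₁ T₁, f |u z| = ∫ z in box n r₁ T₁, f |u z| * φ z := by
          refine setIntegral_congr_fun (measurableSet_box n _ _) fun z hz => ?_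
          rw [hφ, boxCutoff_eq_one hδ hτ (by rwa [e₁, e₂]), mul_one]
      _ ≤ _ := setIntegral_mono_set hfφ
          (Eventually.of_forall fun z => mul_nonneg (hf0 _ (abs_nonneg _))
            (boxCutoff_nonneg hδ hδr hτ hτT z))
          (box_subset_box n hr.le hT.le).eventuallyLE
  have hIu : 0 ≤ (1 / (T₂ - T₁)) ^ k * ∫ z in E, |u z| :=
    mul_nonneg (by positivity) (integral_nonneg fun _ => abs_nonneg _)
  have hIp : 0 ≤ (1 / (r₂ - r₁)) ^ m * ∫ z in E, |u z| ^ p :=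
    mul_nonneg (by positivity) (integral_nonneg fun _ => by positivity)
  have hC0 : 0 ≤ C := by linarith
  nlinarith [mul_nonneg (mul_nonneg (mul_nonneg hN hA.le) hC0) hIu, mul_nonneg hC0 hIp]

section GoodF

variable {p : ℝ} {f : ℝ → ℝ}

lemma continuousOn_Ici_of_monotoneOn_of_convexOn {g : ℝ → ℝ} (hg : MonotoneOn g (Ici 0))
    (hc : ConvexOn ℝ (Ici 0) g) : ContinuousOn g (Ici 0) := by
  refine hc.continuousOn_Ici ?_
  have h₁ : Tendsto (fun x : ℝ => (1 - x) * g 0 + x * g 1) (nhdsWithin 0 (Ici 0)) (nhds (g 0)) := by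
    have : Continuous fun x : ℝ => (1 - x) * g 0 + x * g 1 := by fun_prop
    simpa using (this.tendsto 0).mono_left nhdsWithin_le_nhds
  refine tendsto_of_tendsto_of_tendsto_of_le_of_le' tendsto_const_nhds h₁ ?_ ?_
  · filter_upwards [self_mem_nhdsWithin] with x hx using hg (by simp) hx hx
  · have hlt : ∀ᶠ x : ℝ in nhdsWithin 0 (Ici 0), x < 1 :=
      nhdsWithin_le_nhds (Iio_mem_nhds zero_lt_one)
    filter_upwards [self_mem_nhdsWithin, hlt] with x hx hx1
    have := hc.2 (mem_Ici.2 le_rfl) (mem_Ici.2 zero_le_one) (sub_nonneg.2 hx1.le) hx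
      (sub_add_cancel 1 x)
    simpa using this

lemma GoodF.continuousOn (hf : GoodF p f) : ContinuousOn f (Ici 0) :=
  continuousOn_Ici_of_monotoneOn_of_convexOn hf.1 hf.2.1

lemma GoodF.nonneg (hf : GoodF p f) {x : ℝ} (hx : 0 ≤ x) : 0 ≤ f x := by
  have h₀ : 0 ≤ f 0 := by
    have ht : Tendsto f (nhdsWithin 0 (Ioi 0)) (nhds (f 0)) :=
      (hf.continuousOn 0 (by simp)).mono_left (nhdsWithin_mono _ Ioi_subset_Ici_self)
    refine ge_of_tendsto ht ?_
    filter_upwards [self_mem_nhdsWithin] with x hx using (hf.2.2.2.2 x hx).le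
  exact h₀.trans (hf.1 (by simp) hx hx)

/-- Jensen's inequality for `ζ ↦ f ζ` and `ζ ↦ f (ζ ^ (1 / p))` simultaneously. -/
lemma GoodF.exists_mean (hf : GoodF p f) (hp : 0 < p) {α : Type*} [MeasurableSpace α]
    {μ : Measure α} {E : Set α} (h0 : μ E ≠ 0) (ht : μ E ≠ ⊤) {u : α → ℝ}
    (hu : IntegrableOn u E μ) (hup : IntegrableOn (fun z => |u z| ^ p) E μ)
    (huf : IntegrableOn (fun z => f |u z|) E μ) :
    ∃ h : ℝ, 0 ≤ h ∧ ∫ z in E, |u z| ∂μ ≤ μ.real E * h ∧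
      ∫ z in E, |u z| ^ p ∂μ ≤ μ.real E * h ^ p ∧ μ.real E * f h ≤ ∫ z in E, f |u z| ∂μ := by
  have hE : 0 < μ.real E := ENNReal.toReal_pos h0 ht
  have hpow : ∀ z, (|u z| ^ p) ^ (1 / p) = |u z| := fun z => by
    rw [one_div, rpow_rpow_inv (abs_nonneg _) hp.ne']
  have j₁ := hf.2.1.map_set_average_le hf.continuousOn isClosed_Ici h0 ht
    (Eventually.of_forall fun z => abs_nonneg (u z)) hu.abs huf
  have j₂ := hf.2.2.2.1.map_set_average_le
    (continuousOn_Ici_of_monotoneOn_of_convexOn hf.2.2.1 hf.2.2.2.1) isClosed_Ici h0 ht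
    (Eventually.of_forall fun z => rpow_nonneg (abs_nonneg (u z)) p) hup
    (by simpa only [Function.comp_def, hpow] using huf)
  simp only [hpow] at j₂
  simp only [setAverage_eq, smul_eq_mul] at j₁ j₂
  set I₁ := ∫ z in E, |u z| ∂μ
  set I₂ := ∫ z in E, |u z| ^ p ∂μ
  have hI₁ : 0 ≤ I₁ := integral_nonneg fun _ => abs_nonneg _
  have hI₂ : 0 ≤ I₂ := integral_nonneg fun _ => by positivity
  refine ⟨max ((μ.real E)⁻¹ * I₁) (((μ.real E)⁻¹ * I₂) ^ (1 / p)), ?_, ?_, ?_, ?_⟩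
  · exact le_max_of_le_left (by positivity)
  · have := le_max_left ((μ.real E)⁻¹ * I₁) (((μ.real E)⁻¹ * I₂) ^ (1 / p))
    calc I₁ = μ.real E * ((μ.real E)⁻¹ * I₁) := by field_simp
      _ ≤ _ := mul_le_mul_of_nonneg_left this hE.le
  · have := le_max_right ((μ.real E)⁻¹ * I₁) (((μ.real E)⁻¹ * I₂) ^ (1 / p))
    have h' := rpow_le_rpow (by positivity) this hp.le
    rw [one_div, rpow_inv_rpow (by positivity) hp.ne'] at h'
    calc I₂ = μ.real E * ((μ.real E)⁻¹ * I₂) := by field_simp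
      _ ≤ _ := by rw [one_div]; exact mul_le_mul_of_nonneg_left h' hE.le
  · rw [← le_inv_mul_iff₀ hE]
    rcases max_choice ((μ.real E)⁻¹ * I₁) (((μ.real E)⁻¹ * I₂) ^ (1 / p)) with h | h <;> rw [h]
    exacts [j₁, j₂]

end GoodF

lemma summable_dyadic_of_integrableOn {f : ℝ → ℝ} {q s ε : ℝ} (hq : 0 < q) (hs : 0 < s)
    (hε : 0 < ε) (hf : MonotoneOn f (Ici 0)) (hpos : ∀ x, 0 < x → 0 < f x)
    (hgint : IntegrableOn (fun ζ : ℝ => ζ ^ (q - 1) / f ζ ^ s) (Ioi 1)) :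
    Summable fun i : ℕ => (2 ^ i * ε) ^ q / f (2 ^ i * ε) ^ s := by
  obtain ⟨i₀, hi₀⟩ : ∃ i₀ : ℕ, 1 / ε < 2 ^ i₀ := pow_unbounded_of_one_lt _ one_lt_two
  set x : ℕ → ℝ := fun i => 2 ^ (i + i₀) * ε with hx
  have hx1 : ∀ i, 1 ≤ x i := fun i => by
    rw [div_lt_iff₀ hε] at hi₀
    have : (1 : ℝ) ≤ 2 ^ i := one_le_pow₀ one_le_two
    simp only [hx, pow_add]
    nlinarith
  have hx0 : ∀ i, 0 < x i := fun i => by linarith [hx1 i]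
  have hxs : ∀ i, x (i + 1) = 2 * x i := fun i => by simp only [hx]; ring
  rw [← summable_nat_add_iff (i₀ + 1)]
  have hsh : (fun i : ℕ => ((2 : ℝ) ^ (i + (i₀ + 1)) * ε) ^ q / f (2 ^ (i + (i₀ + 1)) * ε) ^ s)
      = fun i => x (i + 1) ^ q / f (x (i + 1)) ^ s := by
    ext i
    simp only [hx, show i + (i₀ + 1) = i + 1 + i₀ by ring]
  rw [hsh]
  set g : ℝ → ℝ := fun ζ => ζ ^ (q - 1) / f ζ ^ s with hg
  have hg0 : ∀ ζ, 0 < ζ → 0 ≤ g ζ := fun ζ hζ =>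
    div_nonneg (rpow_nonneg hζ.le _) (rpow_nonneg (hpos ζ hζ).le _)
  have hgi : ∀ i j, i ≤ j → IntervalIntegrable g volume (x i) (x j) := fun i j hij => by
    have hle : x i ≤ x j := by
      simp only [hx]
      gcongr
      exact one_le_two
    rw [intervalIntegrable_iff_integrableOn_Ioc_of_le hle]
    exact hgint.mono_set fun ζ hζ => (hx1 i).trans_lt hζ.1
  have h2q : 0 < 1 - (2 : ℝ) ^ (-q) := by
    have := rpow_lt_one_of_one_lt_of_neg (x := 2) one_lt_two (neg_lt_zero.2 hq)
    linarith
  set K := q / (1 - (2 : ℝ) ^ (-q)) with hK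
  have hK0 : 0 < K := by positivity
  have hterm : ∀ i, x (i + 1) ^ q / f (x (i + 1)) ^ s ≤ K * ∫ ζ in x i..x (i + 1), g ζ := by
    intro i
    have hle : x i ≤ x (i + 1) := by rw [hxs]; linarith [hx0 i]
    have hr : IntervalIntegrable (fun ζ : ℝ => ζ ^ (q - 1)) volume (x i) (x (i + 1)) :=
      intervalIntegral.intervalIntegrable_rpow' (by linarith)
    have hlow : ∫ ζ in x i..x (i + 1), ζ ^ (q - 1) / f (x (i + 1)) ^ s ≤
        ∫ ζ in x i..x (i + 1), g ζ := by
      refine intervalIntegral.integral_mono_on hle (hr.div_const _) (hgi i (i + 1) (by omega))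
        fun ζ hζ => ?_
      have hζ0 : 0 < ζ := (hx0 i).trans_le hζ.1
      have hfζ := rpow_le_rpow (hpos ζ hζ0).le
        (hf (mem_Ici.2 hζ0.le) (mem_Ici.2 (hx0 _).le) hζ.2) hs.le
      exact div_le_div_of_nonneg_left (rpow_nonneg hζ0.le _) (rpow_pos_of_pos (hpos ζ hζ0) _) hfζ
    rw [intervalIntegral.integral_div, integral_rpow (Or.inl (by linarith)), sub_add_cancel] at hlow
    have hxq : x i ^ q = x (i + 1) ^ q * 2 ^ (-q) := by
      rw [hxs, mul_rpow zero_le_two (hx0 i).le, rpow_neg zero_le_two]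
      have : (0 : ℝ) < 2 ^ q := by positivity
      field_simp
    calc x (i + 1) ^ q / f (x (i + 1)) ^ s
        = K * ((x (i + 1) ^ q - x i ^ q) / q / f (x (i + 1)) ^ s) := by
          rw [hxq, hK]
          field_simp
      _ ≤ _ := mul_le_mul_of_nonneg_left hlow hK0.le
  refine summable_of_sum_range_le (c := K * ∫ ζ in Ioi 1, g ζ) (fun i =>
    div_nonneg (rpow_nonneg (hx0 _).le _) (rpow_nonneg (hpos _ (hx0 _)).le _)) fun N => ?_
  calc _ ≤ ∑ i ∈ Finset.range N, K * ∫ ζ in x i..x (i + 1), g ζ :=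
        Finset.sum_le_sum fun i _ => hterm i
    _ = K * ∫ ζ in x 0..x N, g ζ := by
        rw [← Finset.mul_sum, intervalIntegral.sum_integral_adjacent_intervals
          fun i _ => hgi i (i + 1) (by omega)]
    _ ≤ _ := by
        refine mul_le_mul_of_nonneg_left ?_ hK0.le
        have hle : x 0 ≤ x N := by
          simp only [hx]
          gcongr
          · exact one_le_two
          · omega
        rw [intervalIntegral.integral_of_le hle]
        have hsub : Ioc (x 0) (x N) ⊆ Ioi 1 := fun ζ hζ => (hx1 0).trans_lt hζ.1
        refine setIntegral_mono_set hgint ?_ hsub.eventuallyLE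
        filter_upwards [ae_restrict_mem measurableSet_Ioi] with ζ hζ
        exact hg0 ζ (zero_lt_one.trans hζ)

lemma mul_rpow_neg_le_sub {A B σ : ℝ} (hA : 0 < A) (hB : 0 < B) (hσ : 0 < σ) :
    σ * (B - A) * B ^ (-(σ + 1)) ≤ A ^ (-σ) - B ^ (-σ) := by
  have hs : 0 < A / B := by positivity
  have h₁ : 1 + σ * (1 - A / B) ≤ (A / B) ^ (-σ) := by
    rw [rpow_def_of_pos hs]
    have := Real.log_le_sub_one_of_pos hs
    have h₂ := Real.add_one_le_exp (Real.log (A / B) * -σ)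
    nlinarith
  have h₂ : A ^ (-σ) = B ^ (-σ) * (A / B) ^ (-σ) := by
    rw [← mul_rpow hB.le hs.le]
    congr 1
    field_simp
  have h₃ : B ^ (-(σ + 1)) = B ^ (-σ) / B := by
    rw [neg_add, rpow_add hB, rpow_neg_one, div_eq_mul_inv]
  rw [h₂, h₃]
  have hBσ : 0 < B ^ (-σ) := by positivity
  calc σ * (B - A) * (B ^ (-σ) / B) = B ^ (-σ) * (1 + σ * (1 - A / B)) - B ^ (-σ) := by
        field_simp
        ring
    _ ≤ _ := by nlinarith

/-- If a positive sequence `F` grows at least as fast as the recursion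
`F (j + 1) - F j ≥ c' (b ^ j) ^ γ f (c F_j ^ q / b ^ j)` with `q γ > 1` prescribes, and the
arguments of `f` are not bounded away from zero, then `∫_0^1 f(r) r^{-1-γ} dr < ∞`. -/
lemma integrableOn_of_recursion {f : ℝ → ℝ} (hf : MonotoneOn f (Ici 0))
    (hfc : ContinuousOn f (Ici 0)) (hf0 : ∀ x, 0 ≤ x → 0 ≤ f x) {γ b q c c' : ℝ} (hγ : 0 < γ)
    (hb : 1 < b) (hq : 0 < q) (hqγ : 1 < q * γ) (hc : 0 < c) (hc' : 0 < c') {F y : ℕ → ℝ}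
    (hF : ∀ j, 0 < F j) (hFm : Monotone F) (hy : ∀ j, y j = c * F j ^ q / b ^ j)
    (hrec : ∀ j, c' * (b ^ j) ^ γ * f (y j) ≤ F (j + 1) - F j)
    (hinf : ∀ ε, 0 < ε → ∃ j, y j < ε) :
    IntegrableOn (fun r : ℝ => f r * r ^ (-1 - γ)) (Ioo 0 1) := by
  have hb0 : 0 < b := by linarith
  have hy0 : ∀ j, 0 < y j := fun j => by
    rw [hy]
    have := rpow_pos_of_pos (hF j) q
    positivity
  set g : ℝ → ℝ := fun r => f r * r ^ (-1 - γ) with hg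
  have hg0 : ∀ r, 0 < r → 0 ≤ g r := fun r hr => mul_nonneg (hf0 r hr.le) (rpow_nonneg hr.le _)
  have hgc : ContinuousOn g (Ioi 0) :=
    (hfc.mono Ioi_subset_Ici_self).mul fun r hr =>
      (continuousAt_rpow_const _ _ (Or.inl (ne_of_gt hr))).continuousWithinAt
  have hgI : ∀ s t, 0 < s → 0 < t → IntervalIntegrable g volume s t := fun s t hs ht =>
    (hgc.mono fun r hr => (lt_min hs ht).trans_le hr.1).intervalIntegrable
  set σ := q * γ - 1 with hσ
  have hσ0 : 0 < σ := by linarith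
  have hcγ : 0 < c ^ γ := rpow_pos_of_pos hc γ
  set K := b ^ (1 + γ) / (c' * c ^ γ) * (b ^ γ / σ) with hK
  have hK0 : 0 < K := by positivity
  have hstep : ∀ j, ∫ r in y (j + 1)..y j, g r ≤ K * (F j ^ (-σ) - F (j + 1) ^ (-σ)) := by
    intro j
    have hmono : F j ≤ F (j + 1) := hFm (Nat.le_succ j)
    have hσm := mul_rpow_neg_le_sub (hF j) (hF (j + 1)) hσ0
    have hFpos : 0 ≤ F (j + 1) ^ (-(σ + 1)) := rpow_nonneg (hF _).le _
    rcases le_or_gt (y j) (y (j + 1)) with hyj | hyj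
    · have h₁ : ∫ r in y (j + 1)..y j, g r ≤ 0 := by
        rw [intervalIntegral.integral_symm, neg_nonpos]
        exact intervalIntegral.integral_nonneg hyj fun r hr => hg0 r ((hy0 j).trans_le hr.1)
      have h₂ : 0 ≤ σ * (F (j + 1) - F j) * F (j + 1) ^ (-(σ + 1)) :=
        mul_nonneg (mul_nonneg hσ0.le (by linarith)) hFpos
      exact h₁.trans (mul_nonneg hK0.le (h₂.trans hσm))
    · have hFq : F (j + 1) ^ q ≤ b * F j ^ q := by
        rw [hy, hy, div_lt_div_iff₀ (by positivity) (by positivity), pow_succ] at hyj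
        have hbc : 0 < c * b ^ j := by positivity
        by_contra! h
        nlinarith [mul_lt_mul_of_pos_left h hbc]
      have hyb : y j / b ≤ y (j + 1) := by
        have hq' := rpow_le_rpow (hF j).le hmono hq.le
        rw [hy, hy, pow_succ, div_div]
        gcongr
      have h₁ : ∫ r in y (j + 1)..y j, g r ≤ f (y j) * (y j / b) ^ (-1 - γ) * y j := by
        have hbd : ∀ r ∈ Icc (y (j + 1)) (y j), g r ≤ f (y j) * (y j / b) ^ (-1 - γ) := by
          intro r hr
          have hr0 : 0 < r := (hy0 _).trans_le hr.1
          exact mul_le_mul (hf (mem_Ici.2 hr0.le) (mem_Ici.2 (hy0 j).le) hr.2)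
            (rpow_le_rpow_of_nonpos (div_pos (hy0 j) hb0) (hyb.trans hr.1) (by linarith))
            (rpow_nonneg hr0.le _) (hf0 _ (hy0 j).le)
        have hnn : 0 ≤ f (y j) * (y j / b) ^ (-1 - γ) :=
          mul_nonneg (hf0 _ (hy0 j).le) (rpow_nonneg (div_pos (hy0 j) hb0).le _)
        calc _ ≤ ∫ _r in y (j + 1)..y j, f (y j) * (y j / b) ^ (-1 - γ) :=
              intervalIntegral.integral_mono_on hyj.le (hgI _ _ (hy0 _) (hy0 _))
                intervalIntegrable_const hbd
          _ = (y j - y (j + 1)) * (f (y j) * (y j / b) ^ (-1 - γ)) := by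
              rw [intervalIntegral.integral_const, smul_eq_mul]
          _ ≤ _ := by nlinarith [hy0 (j + 1)]
      have hbj : (b ^ j) ^ γ = c ^ γ * F j ^ (q * γ) / y j ^ γ := by
        have hFjq := rpow_pos_of_pos (hF j) q
        have hbe : b ^ j = c * F j ^ q / y j := by
          rw [hy]
          field_simp
        rw [hbe, div_rpow (by positivity) (hy0 j).le, mul_rpow hc.le hFjq.le,
          ← rpow_mul (hF j).le]
      have hyγ : (y j / b) ^ (-1 - γ) * y j = b ^ (1 + γ) / y j ^ γ := by
        rw [div_rpow (hy0 j).le hb0.le, sub_eq_add_neg, rpow_add (hy0 j), rpow_neg_one,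
          rpow_neg (hy0 j).le, ← neg_add, rpow_neg hb0.le]
        have := hy0 j
        have := rpow_pos_of_pos (hy0 j) γ
        field_simp
      have hr := hrec j
      rw [hbj] at hr
      have hFqγ : F (j + 1) ^ (q * γ) ≤ b ^ γ * F j ^ (q * γ) := by
        rw [rpow_mul (hF _).le, rpow_mul (hF _).le, ← mul_rpow hb0.le (rpow_nonneg (hF j).le _)]
        exact rpow_le_rpow (rpow_nonneg (hF _).le _) hFq hγ.le
      have hFj := rpow_pos_of_pos (hF j) (q * γ)
      have hFj1 := rpow_pos_of_pos (hF (j + 1)) (q * γ)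
      have hyγ0 := rpow_pos_of_pos (hy0 j) γ
      have hbγ : 0 < b ^ γ := rpow_pos_of_pos hb0 γ
      have hb1γ : 0 < b ^ (1 + γ) := rpow_pos_of_pos hb0 _
      have h₂ : f (y j) * (y j / b) ^ (-1 - γ) * y j ≤
          b ^ (1 + γ) / (c' * c ^ γ) * ((F (j + 1) - F j) / F j ^ (q * γ)) := by
        rw [mul_assoc, hyγ]
        calc f (y j) * (b ^ (1 + γ) / y j ^ γ)
            = b ^ (1 + γ) / (c' * c ^ γ) *
              ((c' * (c ^ γ * F j ^ (q * γ) / y j ^ γ) * f (y j)) / F j ^ (q * γ)) := by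
              generalize F j ^ (q * γ) = X at hFj
              field_simp
          _ ≤ _ := by gcongr
      have h₃ : (F (j + 1) - F j) / F j ^ (q * γ) ≤
          b ^ γ / σ * (F j ^ (-σ) - F (j + 1) ^ (-σ)) := by
        have hσ1 : σ + 1 = q * γ := by rw [hσ]; ring
        rw [hσ1, rpow_neg (hF _).le] at hσm
        calc (F (j + 1) - F j) / F j ^ (q * γ)
            ≤ b ^ γ / σ * (σ * (F (j + 1) - F j) * (F (j + 1) ^ (q * γ))⁻¹) := by
              rw [show b ^ γ / σ * (σ * (F (j + 1) - F j) * (F (j + 1) ^ (q * γ))⁻¹)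
                = (F (j + 1) - F j) * b ^ γ / F (j + 1) ^ (q * γ) by field_simp,
                div_le_div_iff₀ hFj hFj1, mul_assoc]
              exact mul_le_mul_of_nonneg_left hFqγ (by linarith)
          _ ≤ _ := by gcongr
      calc _ ≤ _ := h₁.trans h₂
        _ ≤ b ^ (1 + γ) / (c' * c ^ γ) * (b ^ γ / σ * (F j ^ (-σ) - F (j + 1) ^ (-σ))) := by
            gcongr
        _ = _ := by rw [hK]; ring
  have hsum : ∀ j, ∫ r in y j..y 0, g r ≤ K * (F 0 ^ (-σ) - F j ^ (-σ)) := by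
    intro j
    induction j with
    | zero => simp
    | succ j ih =>
      rw [← intervalIntegral.integral_add_adjacent_intervals (hgI _ (y j) (hy0 _) (hy0 _))
        (hgI _ _ (hy0 _) (hy0 _))]
      linarith [hstep j]
  have hIoc : IntegrableOn g (Ioc 0 (y 0)) := by
    have hset : ∀ s, 0 < s → IntegrableOn g (Ioc s (y 0)) := fun s hs =>
      ((hgc.mono fun r hr => hs.trans_le hr.1).integrableOn_Icc).mono_set Ioc_subset_Icc_self
    refine integrableOn_Ioc_of_intervalIntegral_norm_bounded_left (I := K * F 0 ^ (-σ))
      (a := fun i : ℕ => 1 / ((i : ℝ) + 1)) (l := atTop)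
      (fun i => hset _ (by positivity)) tendsto_one_div_add_atTop_nhds_zero_nat
      (Eventually.of_forall fun i => ?_)
    have hi : 0 < 1 / ((i : ℝ) + 1) := by positivity
    obtain ⟨j, hj⟩ := hinf (min (1 / ((i : ℝ) + 1)) (y 0)) (lt_min hi (hy0 0))
    have hj₁ := (lt_min_iff.1 hj).1
    have hj₂ := (lt_min_iff.1 hj).2
    calc ∫ r in Ioc (1 / ((i : ℝ) + 1)) (y 0), ‖g r‖
        = ∫ r in Ioc (1 / ((i : ℝ) + 1)) (y 0), g r := by
          refine setIntegral_congr_fun measurableSet_Ioc fun r hr => ?_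
          exact (Real.norm_eq_abs _).trans (abs_of_nonneg (hg0 r (hi.trans hr.1)))
      _ ≤ ∫ r in Ioc (y j) (y 0), g r := by
          refine setIntegral_mono_set (hset _ (hy0 j)) ?_ (Ioc_subset_Ioc_left hj₁.le).eventuallyLE
          filter_upwards [ae_restrict_mem measurableSet_Ioc] with r hr
          exact hg0 r ((hy0 j).trans hr.1)
      _ = ∫ r in y j..y 0, g r := (intervalIntegral.integral_of_le hj₂.le).symm
      _ ≤ K * (F 0 ^ (-σ) - F j ^ (-σ)) := hsum j
      _ ≤ _ := mul_le_mul_of_nonneg_left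
          (by linarith [rpow_nonneg (hF j).le (-σ)]) hK0.le
  have hIcc : IntegrableOn g (Icc (y 0) 1) :=
    (hgc.mono fun r hr => (hy0 0).trans_le hr.1).integrableOn_Icc
  refine (hIoc.union hIcc).mono_set fun r hr => ?_
  rcases le_total r (y 0) with h | h
  · exact Or.inl ⟨hr.1, h⟩
  · exact Or.inr ⟨h, hr.2.le⟩

section Boxes

variable {n k m : ℕ} {p : ℝ} {f : ℝ → ℝ} {u : Spc n × ℝ → ℝ}

lemma integrals_le_of_integral_lt (hp : 0 < p) (hf : GoodF p f)
    (hu : ∀ r T, IntegrableOn u (box n r T)) (hup : ∀ r T, IntegrableOn (|u ·| ^ p) (box n r T))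
    (huf : ∀ r T, IntegrableOn (fun z => f |u z|) (box n r T)) {r T v x : ℝ} (hr : 0 < r)
    (hT : 0 < T) (hv : v ≤ (2 * r) ^ n * T) (hx : 0 ≤ x)
    (hlt : ∫ z in box n r T, f |u z| < v * f x) :
    ∫ z in box n r T, |u z| ≤ (2 * r) ^ n * T * x ∧
      ∫ z in box n r T, |u z| ^ p ≤ (2 * r) ^ n * T * x ^ p := by
  have hV : 0 < (2 * r) ^ n * T := by positivity
  have hV' := volume_real_box n hr hT
  obtain ⟨h, hh, h₁, h₂, h₃⟩ := hf.exists_mean hp (μ := volume) (E := box n r T) (u := u)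
    (fun h0 => by rw [Measure.real, h0] at hV'; simp only [ENNReal.toReal_zero] at hV'; linarith)
    (by rw [volume_box n hr]; exact ENNReal.ofReal_ne_top) (hu r T) (hup r T) (huf r T)
  rw [hV'] at h₁ h₂ h₃
  have hlt' : (2 * r) ^ n * T * f h < (2 * r) ^ n * T * f x :=
    h₃.trans_lt (hlt.trans_le (mul_le_mul_of_nonneg_right hv (hf.nonneg hx)))
  have hhx : h ≤ x := by
    by_contra! hxh
    exact absurd (hf.1 (mem_Ici.2 hx) (mem_Ici.2 hh) hxh.le)
      (not_le.2 (lt_of_mul_lt_mul_left hlt' hV.le))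
  exact ⟨h₁.trans (by gcongr), h₂.trans (by gcongr)⟩

/-- A Keller–Osserman type bound: under the energy estimate and `Cond14`, `Cond15`, the mean
value of `f |u|` over the box of size `(R, R ^ κ)` tends to `f 0` as `R → ∞`. -/
lemma exists_forall_integral_lt (hk : 1 ≤ k) (hm : 1 ≤ m) (hp : 0 < p) (hf : GoodF p f)
    (h14 : Cond14 k f) (h15 : Cond15 m p f)
    (hu : ∀ r T, IntegrableOn u (box n r T)) (hup : ∀ r T, IntegrableOn (|u ·| ^ p) (box n r T))
    (huf : ∀ r T, IntegrableOn (fun z => f |u z|) (box n r T)) {C : ℝ} (hC : 0 < C)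
    (henergy : ∀ r₁ r₂ T₁ T₂ : ℝ, 0 < r₁ → r₁ < r₂ → 0 < T₁ → T₁ < T₂ →
      ∫ z in box n r₁ T₁, f |u z| ≤
        C * ((1 / (T₂ - T₁)) ^ k * ∫ z in box n r₂ T₂ \ box n r₁ T₁, |u z|)
        + C * ((1 / (r₂ - r₁)) ^ m * ∫ z in box n r₂ T₂ \ box n r₁ T₁, |u z| ^ p))
    {κ c ε : ℝ} (hκ : 0 < κ) (hc : 0 < c) (hc1 : c ≤ 1) (hε : 0 < ε) :
    ∃ R₀ : ℝ, ∀ R, R₀ ≤ R →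
      ∫ z in box n R (R ^ κ), f |u z| < c * ((2 * R) ^ n * R ^ κ) * f ε := by
  have hfpos := hf.2.2.2.2
  have hk0 : (0 : ℝ) < k := by exact_mod_cast hk
  have hm0 : (0 : ℝ) < m := by exact_mod_cast hm
  set x : ℕ → ℝ := fun i => 2 ^ i * ε with hx
  have hx0 : ∀ i, 0 < x i := fun i => by positivity
  have hxs : ∀ i, x (i + 1) = 2 * x i := fun i => by simp only [hx]; ring
  set a : ℕ → ℝ := fun i => x i ^ ((k : ℝ)⁻¹) / f (x i) ^ ((k : ℝ)⁻¹) with ha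
  set b : ℕ → ℝ := fun i => x i ^ (p / m) / f (x i) ^ ((m : ℝ)⁻¹) with hb
  have hsa : Summable a :=
    summable_dyadic_of_integrableOn (by positivity) (by positivity) hε hf.1 hfpos h14
  have hsb : Summable b :=
    summable_dyadic_of_integrableOn (by positivity) (by positivity) hε hf.1 hfpos h15
  have hfx : ∀ i, 0 < f (x i) := fun i => hfpos _ (hx0 i)
  have ha0 : ∀ i, 0 < a i := fun i =>
    div_pos (rpow_pos_of_pos (hx0 i) _) (rpow_pos_of_pos (hfx i) _)
  have hb0 : ∀ i, 0 < b i := fun i =>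
    div_pos (rpow_pos_of_pos (hx0 i) _) (rpow_pos_of_pos (hfx i) _)
  have hak : ∀ i, a i ^ k = x i / f (x i) := fun i => by
    simp only [ha]
    rw [div_pow, rpow_inv_natCast_pow (hx0 i).le (by omega),
      rpow_inv_natCast_pow (hfx i).le (by omega)]
  have hbm : ∀ i, b i ^ m = x i ^ p / f (x i) := fun i => by
    simp only [hb]
    rw [div_pow, div_eq_mul_inv p, rpow_mul (hx0 i).le,
      rpow_inv_natCast_pow (rpow_nonneg (hx0 i).le _) (by omega),
      rpow_inv_natCast_pow (hfx i).le (by omega)]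
  have h2p : (0 : ℝ) < 2 ^ p := by positivity
  set B := C * 2 ^ (n + 1) * (2 + 2 ^ p) with hB
  have hB0 : 0 < B := by positivity
  set K := 1 + B / c with hK
  have hK1 : 1 ≤ K := by rw [hK]; linarith [div_pos hB0 hc]
  have hK0 : 0 < K := by linarith
  have hBK : B / K < c := by
    rw [div_lt_iff₀ hK0, hK, mul_add, mul_div_cancel₀ _ hc.ne']
    linarith
  have hev : ∀ᶠ R : ℝ in atTop, 0 < R ∧ K * ∑' i, b i ≤ R ∧ K * ∑' i, a i ≤ R ^ κ :=
    (eventually_gt_atTop 0).and ((eventually_ge_atTop _).and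
      ((tendsto_rpow_atTop hκ).eventually_ge_atTop _))
  obtain ⟨R₀, hR₀⟩ := eventually_atTop.1 hev
  refine ⟨R₀, fun R hR => ?_⟩
  obtain ⟨hRpos, hRb, hRa⟩ := hR₀ R hR
  have hRκ : 0 < R ^ κ := rpow_pos_of_pos hRpos κ
  set v := (2 * R) ^ n * R ^ κ with hv
  have hv0 : 0 < v := by positivity
  by_contra! hbase
  set r : ℕ → ℝ := fun i => R + K * ∑ j ∈ Finset.range i, b j with hr
  set T : ℕ → ℝ := fun i => R ^ κ + K * ∑ j ∈ Finset.range i, a j with hT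
  have hsumb : ∀ i, 0 ≤ K * ∑ j ∈ Finset.range i, b j := fun i =>
    mul_nonneg hK0.le (Finset.sum_nonneg fun j _ => (hb0 j).le)
  have hsuma : ∀ i, 0 ≤ K * ∑ j ∈ Finset.range i, a j := fun i =>
    mul_nonneg hK0.le (Finset.sum_nonneg fun j _ => (ha0 j).le)
  have hr1 : ∀ i, R ≤ r i := fun i => by simp only [hr]; linarith [hsumb i]
  have hT1 : ∀ i, R ^ κ ≤ T i := fun i => by simp only [hT]; linarith [hsuma i]
  have hr2 : ∀ i, r i ≤ 2 * R := fun i => by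
    have := mul_le_mul_of_nonneg_left
      (hsb.sum_le_tsum (Finset.range i) fun j _ => (hb0 j).le) hK0.le
    simp only [hr]
    linarith
  have hT2 : ∀ i, T i ≤ 2 * R ^ κ := fun i => by
    have := mul_le_mul_of_nonneg_left
      (hsa.sum_le_tsum (Finset.range i) fun j _ => (ha0 j).le) hK0.le
    simp only [hT]
    linarith
  have hrs : ∀ i, r (i + 1) - r i = K * b i := fun i => by
    simp only [hr, Finset.sum_range_succ]; ring
  have hTs : ∀ i, T (i + 1) - T i = K * a i := fun i => by
    simp only [hT, Finset.sum_range_succ]; ring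
  have hclaim : ∀ i, c * v * f (x i) ≤ ∫ z in box n (r i) (T i), f |u z| := by
    intro i
    induction i with
    | zero => simpa [hr, hT, hx] using hbase
    | succ i ih =>
      by_contra! hlt
      have hri : 0 < r (i + 1) := hRpos.trans_le (hr1 _)
      have hTi : 0 < T (i + 1) := hRκ.trans_le (hT1 _)
      have hvol₁ : v ≤ (2 * r (i + 1)) ^ n * T (i + 1) := by
        rw [hv]
        gcongr
        · exact hr1 _
        · exact hT1 _
      have hvol₂ : (2 * r (i + 1)) ^ n * T (i + 1) ≤ 2 ^ (n + 1) * v := by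
        calc _ ≤ (2 * (2 * R)) ^ n * (2 * R ^ κ) := by
              gcongr
              · exact hr2 _
              · exact hT2 _
          _ = _ := by rw [hv, mul_pow 2 (2 * R)]; ring
      obtain ⟨h₁, h₂⟩ := integrals_le_of_integral_lt hp hf hu hup huf hri hTi
        ((mul_le_of_le_one_left hv0.le hc1).trans hvol₁) (hx0 (i + 1)).le hlt
      have hE₁ : ∫ z in box n (r (i + 1)) (T (i + 1)) \ box n (r i) (T i), |u z| ≤
          2 ^ (n + 1) * v * (2 * x i) := by
        refine (setIntegral_mono_set (hu _ _).abs (Eventually.of_forall fun z => abs_nonneg _)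
          sdiff_subset.eventuallyLE).trans (h₁.trans ?_)
        rw [hxs]
        exact mul_le_mul_of_nonneg_right hvol₂ (by linarith [hx0 i])
      have hE₂ : ∫ z in box n (r (i + 1)) (T (i + 1)) \ box n (r i) (T i), |u z| ^ p ≤
          2 ^ (n + 1) * v * (2 ^ p * x i ^ p) := by
        refine (setIntegral_mono_set (hup _ _) (Eventually.of_forall fun z => by positivity)
          sdiff_subset.eventuallyLE).trans (h₂.trans ?_)
        rw [hxs, mul_rpow zero_le_two (hx0 i).le]
        have := rpow_pos_of_pos (hx0 i) p
        exact mul_le_mul_of_nonneg_right hvol₂ (by positivity)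
      have hen := henergy (r i) (r (i + 1)) (T i) (T (i + 1)) (hRpos.trans_le (hr1 i))
        (by linarith [hrs i, mul_pos hK0 (hb0 i)]) (hRκ.trans_le (hT1 i))
        (by linarith [hTs i, mul_pos hK0 (ha0 i)])
      rw [hrs, hTs] at hen
      have hinv : ∀ j : ℕ, 1 ≤ j → (1 / K) ^ j ≤ 1 / K := fun j hj =>
        pow_le_of_le_one (by positivity) ((div_le_one hK0).2 hK1) (by omega)
      have hxp := rpow_pos_of_pos (hx0 i) p
      have hfi := hfx i
      have hxi := hx0 i
      have hF₁ : (1 / (K * a i)) ^ k * ∫ z in box n (r (i + 1)) (T (i + 1)) \ box n (r i) (T i),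
          |u z| ≤ 1 / K * (2 ^ (n + 1) * v * 2 * f (x i)) := by
        have e : (1 / (K * a i)) ^ k = (1 / K) ^ k * (f (x i) / x i) := by
          rw [one_div, one_div, mul_inv, mul_pow, inv_pow (a i), hak, inv_div]
        rw [e]
        calc _ ≤ 1 / K * (f (x i) / x i) * (2 ^ (n + 1) * v * (2 * x i)) := by
              have := hinv k hk
              gcongr
          _ = _ := by field_simp
      have hF₂ : (1 / (K * b i)) ^ m * ∫ z in box n (r (i + 1)) (T (i + 1)) \ box n (r i) (T i),
          |u z| ^ p ≤ 1 / K * (2 ^ (n + 1) * v * 2 ^ p * f (x i)) := by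
        have e : (1 / (K * b i)) ^ m = (1 / K) ^ m * (f (x i) / x i ^ p) := by
          rw [one_div, one_div, mul_inv, mul_pow, inv_pow (b i), hbm, inv_div]
        rw [e]
        calc _ ≤ 1 / K * (f (x i) / x i ^ p) * (2 ^ (n + 1) * v * (2 ^ p * x i ^ p)) := by
              have := hinv m hm
              gcongr
          _ = _ := by field_simp
      have hfin : ∫ z in box n (r i) (T i), f |u z| ≤ B / K * (v * f (x i)) :=
        calc _ ≤ C * (1 / K * (2 ^ (n + 1) * v * 2 * f (x i))) +
              C * (1 / K * (2 ^ (n + 1) * v * 2 ^ p * f (x i))) := by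
              refine hen.trans ?_
              gcongr
          _ = _ := by rw [hB]; ring
      have := mul_lt_mul_of_pos_right hBK (mul_pos hv0 hfi)
      linarith
  have hbdd : ∀ i, c * v * f (x i) ≤ ∫ z in box n (2 * R) (2 * R ^ κ), f |u z| := fun i =>
    (hclaim i).trans (setIntegral_mono_set (huf _ _)
      (Eventually.of_forall fun z => hf.nonneg (abs_nonneg _))
      (box_subset_box n (hr2 i) (hT2 i)).eventuallyLE)
  have hcvε : 0 < c * v * ε := by positivity
  have h₁ : ∀ᶠ i in atTop, a i < 1 := hsa.tendsto_atTop_zero.eventually_lt_const zero_lt_one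
  have h₂ : ∀ᶠ i : ℕ in atTop,
      (∫ z in box n (2 * R) (2 * R ^ κ), f |u z|) / (c * v * ε) < 2 ^ i :=
    (tendsto_pow_atTop_atTop_of_one_lt one_lt_two).eventually_gt_atTop _
  obtain ⟨i, hi₁, hi₂⟩ := (h₁.and h₂).exists
  have h₃ : x i ≤ f (x i) := by
    have := pow_le_one₀ (ha0 i).le hi₁.le (n := k)
    rwa [hak, div_le_one (hfx i)] at this
  rw [div_lt_iff₀ hcvε] at hi₂
  have h₄ := mul_le_mul_of_nonneg_left h₃ (mul_pos hc hv0).le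
  have h₅ : (2 : ℝ) ^ i * (c * v * ε) = c * v * x i := by simp only [hx]; ring
  linarith [hbdd i]

end Boxes

lemma exists_mul_rpow_le_of_le_add_rpow {p C c₀ : ℝ} (hp : 0 < p) (hC : 0 < C) (hc₀ : 0 < c₀) :
    ∃ c : ℝ, 0 < c ∧ ∀ F Y : ℝ, c₀ ≤ F → 0 ≤ Y → F ≤ C * (Y + Y ^ p) →
      c * F ^ min 1 (1 / p) ≤ Y := by
  set q := min 1 (1 / p) with hq
  have key : ∀ (s D F Y : ℝ), q ≤ s → 0 < D → c₀ ≤ F → D * F ^ s ≤ Y →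
      D * c₀ ^ (s - q) * F ^ q ≤ Y := by
    intro s D F Y hs hD hF hY
    have hF0 : 0 < F := hc₀.trans_le hF
    have h₁ : c₀ ^ (s - q) ≤ F ^ (s - q) := rpow_le_rpow hc₀.le hF (by linarith)
    have h₂ : F ^ s = F ^ (s - q) * F ^ q := by rw [← rpow_add hF0, sub_add_cancel]
    have h₃ : 0 < F ^ q := rpow_pos_of_pos hF0 q
    calc _ ≤ D * F ^ (s - q) * F ^ q := by gcongr
      _ = D * F ^ s := by rw [h₂, mul_assoc]
      _ ≤ Y := hY
  have hD₂ : 0 < (1 / (2 * C)) ^ (1 / p) := rpow_pos_of_pos (by positivity) _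
  refine ⟨min (1 / (2 * C) * c₀ ^ (1 - q)) ((1 / (2 * C)) ^ (1 / p) * c₀ ^ (1 / p - q)),
    lt_min (by positivity) (by positivity), fun F Y hF hY hFY => ?_⟩
  have hF0 : 0 < F := hc₀.trans_le hF
  have hFq : 0 ≤ F ^ q := rpow_nonneg hF0.le q
  rcases le_total (F / (2 * C)) Y with h | h
  · refine (mul_le_mul_of_nonneg_right (min_le_left _ _) hFq).trans ?_
    refine key 1 _ F Y (min_le_left _ _) (by positivity) hF ?_
    rw [rpow_one, one_div_mul_eq_div]
    exact h
  · refine (mul_le_mul_of_nonneg_right (min_le_right _ _) hFq).trans ?_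
    refine key (1 / p) _ F Y (min_le_right _ _) hD₂ hF ?_
    have h' : F / (2 * C) ≤ Y ^ p := by
      rw [div_le_iff₀ (by positivity)]
      rw [le_div_iff₀ (by positivity)] at h
      nlinarith
    rw [← mul_rpow (by positivity) hF0.le, one_div_mul_eq_div]
    calc _ ≤ (Y ^ p) ^ (1 / p) := rpow_le_rpow (by positivity) h' (by positivity)
      _ = Y := by rw [one_div, rpow_rpow_inv hY hp.ne']

section Dyadic

variable {n k m : ℕ} {p : ℝ} {f : ℝ → ℝ} {u : Spc n × ℝ → ℝ}

/-- The relations between the scaling exponents `κ` (of the boxes of size `(R, R ^ κ)`), `l` (of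
the mean value of `|u|`) and `γ`. -/
lemma exists_scaling_exponents (hn : 1 ≤ n) (hk : 1 ≤ k) (hp : 0 < p)
    (hdim : (m : ℝ) * (1 - 1 / (k : ℝ)) < n) (hp' : 1 - (m : ℝ) / (n : ℝ) < p)
    {γ : ℝ} (hγ : γ = ((n : ℝ) * p + (m : ℝ) / (k : ℝ)) / ((n : ℝ) - (1 - 1 / (k : ℝ)) * (m : ℝ))) :
    ∃ κ l : ℝ, 0 < κ ∧ 0 < l ∧ l + κ * k = n + κ ∧ l * p + m = n + κ ∧ l * γ = n + κ := by
  have hn0 : (0 : ℝ) < n := by exact_mod_cast hn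
  have hk1 : (1 : ℝ) ≤ k := by exact_mod_cast hk
  have hk0 : (0 : ℝ) < k := by linarith
  obtain ⟨D, hD_eq⟩ : ∃ D : ℝ, D = 1 + p * (k - 1) := ⟨_, rfl⟩
  have hD : 0 < D := by nlinarith [mul_nonneg hp.le (sub_nonneg.2 hk1)]
  have hden : 0 < (n : ℝ) - (1 - 1 / (k : ℝ)) * m := by linarith
  have hden' : (n : ℝ) * k - (k - 1) * m = k * ((n : ℝ) - (1 - 1 / (k : ℝ)) * m) := by
    field_simp
  have hnum : 0 < (n : ℝ) * (p - 1) + m := by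
    rw [sub_lt_comm, lt_div_iff₀ hn0] at hp'
    nlinarith
  refine ⟨((n : ℝ) * (p - 1) + m) / D,
    ((n : ℝ) * k - (k - 1) * m) / D, div_pos hnum hD,
    div_pos (by rw [hden']; positivity) hD, ?_, ?_, ?_⟩
  · field_simp
    rw [hD_eq]
    ring
  · field_simp
    rw [hD_eq]
    ring
  · rw [hγ, hden', div_mul_div_comm, mul_right_comm, mul_div_mul_right _ _ hden.ne', mul_add,
      mul_div_cancel₀ _ hk0.ne']
    field_simp
    rw [hD_eq]
    ring

lemma volume_real_box_dyadic (n : ℕ) (κ : ℝ) {X : ℝ} (hX : 0 < X) :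
    volume.real (box n X (X ^ κ)) = 2 ^ n * X ^ (n + κ) := by
  rw [volume_real_box n hX (rpow_pos_of_pos hX κ), mul_pow, rpow_add hX, rpow_natCast, mul_assoc]

lemma volume_real_box_sdiff (n : ℕ) {κ X : ℝ} (hκ : 0 < κ) (hX : 0 < X) :
    volume.real (box n (2 * X) ((2 * X) ^ κ) \ box n X (X ^ κ)) =
      (2 ^ (n + κ) - 1) * 2 ^ n * X ^ (n + κ) := by
  rw [measureReal_sdiff (box_subset_box n (by linarith)
      (rpow_le_rpow hX.le (by linarith) hκ.le)) (measurableSet_box n _ _)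
      (by rw [volume_box n (by positivity)]; exact ENNReal.ofReal_ne_top),
    volume_real_box_dyadic n κ hX, volume_real_box_dyadic n κ (by positivity),
    mul_rpow zero_le_two hX.le]
  ring

/-- One dyadic step: comparison of the energy in the box of size `(X, X ^ κ)` with its increment
up to the box of size `(2X, (2X) ^ κ)`, in terms of a mean value `h` of `|u|`. -/
lemma exists_dyadic_step (hp : 0 < p) (hf : GoodF p f)
    (hu : ∀ r T, IntegrableOn u (box n r T)) (hup : ∀ r T, IntegrableOn (|u ·| ^ p) (box n r T))
    (huf : ∀ r T, IntegrableOn (fun z => f |u z|) (box n r T)) {C : ℝ} (hC : 0 < C)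
    (henergy : ∀ r₁ r₂ T₁ T₂ : ℝ, 0 < r₁ → r₁ < r₂ → 0 < T₁ → T₁ < T₂ →
      ∫ z in box n r₁ T₁, f |u z| ≤
        C * ((1 / (T₂ - T₁)) ^ k * ∫ z in box n r₂ T₂ \ box n r₁ T₁, |u z|)
        + C * ((1 / (r₂ - r₁)) ^ m * ∫ z in box n r₂ T₂ \ box n r₁ T₁, |u z| ^ p))
    {κ l : ℝ} (hκ : 0 < κ) (hlk : l + κ * k = n + κ) (hlm : l * p + m = n + κ) :
    ∃ C' : ℝ, 0 < C' ∧ ∀ X : ℝ, 0 < X → ∃ h : ℝ, 0 ≤ h ∧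
      ∫ z in box n X (X ^ κ), f |u z| ≤ C' * (X ^ l * h + (X ^ l * h) ^ p) ∧
      (2 ^ (n + κ) - 1) * 2 ^ n * X ^ (n + κ) * f h ≤
        (∫ z in box n (2 * X) ((2 * X) ^ κ), f |u z|) - ∫ z in box n X (X ^ κ), f |u z| := by
  have hκ2 : (1 : ℝ) < 2 ^ κ := one_lt_rpow one_lt_two hκ
  have hν : (0 : ℝ) < 2 ^ (n + κ) - 1 :=
    sub_pos.2 (one_lt_rpow one_lt_two (by positivity))
  set W : ℝ := (2 ^ (n + κ) - 1) * 2 ^ n with hW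
  have hW0 : 0 < W := by positivity
  set M : ℝ := (1 / (2 ^ κ - 1)) ^ k with hM
  have hM0 : 0 < M := pow_pos (one_div_pos.2 (by linarith)) k
  refine ⟨C * W * (1 + M), by positivity, fun X hX => ?_⟩
  have hXκ := rpow_pos_of_pos hX κ
  have hX2 : X ^ κ < (2 * X) ^ κ := rpow_lt_rpow hX.le (by linarith) hκ
  have hvol := volume_real_box_sdiff n hκ hX
  rw [← hW] at hvol
  set E := box n (2 * X) ((2 * X) ^ κ) \ box n X (X ^ κ) with hE
  have hV0 : 0 < W * X ^ (n + κ) := by positivity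
  have hsub : E ⊆ box n (2 * X) ((2 * X) ^ κ) := sdiff_subset
  obtain ⟨h, hh, h₁, h₂, h₃⟩ := hf.exists_mean hp (μ := volume) (E := E) (u := u)
    (fun h0 => by rw [Measure.real, h0] at hvol; simp only [ENNReal.toReal_zero] at hvol; linarith)
    (ne_top_of_le_ne_top (by rw [volume_box n (by positivity)]; exact ENNReal.ofReal_ne_top)
      (measure_mono hsub)) ((hu _ _).mono_set hsub) ((hup _ _).mono_set hsub)
    ((huf _ _).mono_set hsub)
  rw [hvol] at h₁ h₂ h₃
  have hXl := rpow_pos_of_pos hX l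
  refine ⟨h, hh, ?_, ?_⟩
  · have hen := henergy X (2 * X) (X ^ κ) ((2 * X) ^ κ) hX (by linarith) hXκ hX2
    have e₁ : (1 / ((2 * X) ^ κ - X ^ κ)) ^ k * (W * X ^ (n + κ) * h) = W * M * (X ^ l * h) := by
      have : X ^ (n + κ) = X ^ l * (X ^ κ) ^ k := by
        rw [← hlk, rpow_add hX, rpow_mul hX.le, rpow_natCast]
      have h2 : (2 * X) ^ κ - X ^ κ = (2 ^ κ - 1) * X ^ κ := by
        rw [mul_rpow zero_le_two hX.le]; ring
      rw [this, h2, hM, one_div, one_div, mul_inv, mul_pow, inv_pow (X ^ κ)]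
      field_simp
    have e₂ : (1 / (2 * X - X)) ^ m * (W * X ^ (n + κ) * h ^ p) = W * (X ^ l * h) ^ p := by
      have : X ^ (n + κ) = (X ^ l) ^ p * X ^ m := by
        rw [← hlm, rpow_add hX, rpow_mul hX.le, rpow_natCast]
      have h2 : 2 * X - X = X := by ring
      rw [this, h2, mul_rpow hXl.le hh, div_pow, one_pow]
      field_simp
    have hY : 0 ≤ X ^ l * h := by positivity
    have hYp : 0 ≤ (X ^ l * h) ^ p := rpow_nonneg hY p
    have hpos : 0 < (2 * X) ^ κ - X ^ κ := by linarith
    have hposX : 0 < 2 * X - X := by linarith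
    calc _ ≤ C * ((1 / ((2 * X) ^ κ - X ^ κ)) ^ k * (W * X ^ (n + κ) * h)) +
          C * ((1 / (2 * X - X)) ^ m * (W * X ^ (n + κ) * h ^ p)) := by
          refine hen.trans ?_
          gcongr
      _ = C * W * (M * (X ^ l * h) + 1 * (X ^ l * h) ^ p) := by rw [e₁, e₂]; ring
      _ ≤ C * W * ((1 + M) * (X ^ l * h) + (1 + M) * (X ^ l * h) ^ p) := by
          gcongr <;> linarith
      _ = _ := by ring
  · rw [← setIntegral_sdiff (measurableSet_box n _ _) (huf _ _)
      (box_subset_box n (by linarith) hX2.le)]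
    exact h₃

lemma trivialSol_of_forall_integral_eq_zero (hf : GoodF p f)
    (huf : ∀ r T, IntegrableOn (fun z => f |u z|) (box n r T)) {κ : ℝ} (hκ : 0 < κ)
    (h0 : ∀ j : ℕ, ∫ z in box n (2 ^ j) ((2 ^ j) ^ κ), f |u z| = 0) : TrivialSol n u := by
  have hcov : halfSp n ⊆ ⋃ j : ℕ, box n (2 ^ j) ((2 ^ j) ^ κ) := by
    intro z hz
    have h2 : Tendsto (fun j : ℕ => (2 : ℝ) ^ j) atTop atTop :=
      tendsto_pow_atTop_atTop_of_one_lt one_lt_two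
    obtain ⟨j, hj, hj'⟩ := ((h2.eventually_gt_atTop ‖z.1‖).and
      (((tendsto_rpow_atTop hκ).comp h2).eventually_gt_atTop z.2)).exists
    exact mem_iUnion.2 ⟨j, fun i => (PiLp.norm_apply_le z.1 i).trans_lt hj, hz, hj'⟩
  refine ae_restrict_of_ae_restrict_of_subset hcov ((ae_restrict_iUnion_iff _ _).2 fun j => ?_)
  have := (setIntegral_eq_zero_iff_of_nonneg_ae
    (Eventually.of_forall fun z => hf.nonneg (abs_nonneg (u z))) (huf _ _)).1 (h0 j)
  filter_upwards [this] with z hz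
  by_contra hne
  exact (hf.2.2.2.2 _ (abs_pos.2 hne)).ne' hz

end Dyadic

/-- **Theorem 2.1.** If `n > m (1 - 1/k)`, `p > 0`, `p > 1 - m/n`, conditions (1.4),
(1.5) hold, and `∫_0^1 f(r) r^{-1-γ} dr = ∞` with
`γ = (n p + m/k) / (n - (1 - 1/k) m)`, then any global weak solution of problem
(1.1i), (1.1c) is trivial. -/
theorem blowup_supercritical_dimension
    (n k m : ℕ) (hn : 1 ≤ n) (hk : 1 ≤ k) (hm : 1 ≤ m)
    (A p : ℝ) (hA : 0 < A) (hp : 0 < p)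
    (a : (Fin n → ℕ) → Spc n × ℝ → ℝ → ℝ) (ha : GoodCoeffs n m A p a)
    (f : ℝ → ℝ) (hf : GoodF p f)
    (u0 : ℕ → Spc n → ℝ) (hu0 : ∀ i < k, L1locInit n (u0 i))
    (hu0nn : ∀ᵐ x ∂(volume : Measure (Spc n)), 0 ≤ u0 (k - 1) x)
    (h14 : Cond14 k f) (h15 : Cond15 m p f)
    (hdim : (m : ℝ) * (1 - 1 / (k : ℝ)) < n)
    (hp' : 1 - (m : ℝ) / (n : ℝ) < p)
    (γ : ℝ) (hγ : γ = ((n : ℝ) * p + (m : ℝ) / (k : ℝ)) / ((n : ℝ) - (1 - 1 / (k : ℝ)) * (m : ℝ)))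
    (hdiv : ¬ IntegrableOn (fun r : ℝ => f r * r ^ (-1 - γ)) (Ioo 0 1))
    (u : Spc n × ℝ → ℝ) (hu : IsGlobalWeakSol n k m p a f u0 u) :
    TrivialSol n u := by
  have hf0 : ∀ x, 0 ≤ x → 0 ≤ f x := fun x hx => hf.nonneg hx
  obtain ⟨C, hC, henergy⟩ := exists_energy_estimate hk hm hA ha hf0 hu0nn hu
  have hub := fun r T => integrableOn_box n hu.1 r T
  have hup := fun r T => integrableOn_box n hu.2.1 r T
  have huf := fun r T => integrableOn_box n hu.2.2.1 r T
  obtain ⟨κ, l, hκ, hl, hlk, hlm, hlγ⟩ := exists_scaling_exponents hn hk hp hdim hp' hγ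
  obtain ⟨C', hC', hstep⟩ := exists_dyadic_step hp hf hub hup huf hC henergy hκ hlk hlm
  have hk0 : (0 : ℝ) < k := by exact_mod_cast hk
  have hm0 : (0 : ℝ) < m := by exact_mod_cast hm
  have hγ1 : 1 < γ := by
    refine lt_of_mul_lt_mul_left (a := l) ?_ hl.le
    linarith [mul_pos hκ hk0]
  have hγp : p < γ := lt_of_mul_lt_mul_left (a := l) (by linarith) hl.le
  set F : ℕ → ℝ := fun j => ∫ z in box n (2 ^ j) ((2 ^ j) ^ κ), f |u z| with hF
  by_contra hnt
  obtain ⟨j₀, hj₀⟩ : ∃ j, F j ≠ 0 := by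
    by_contra! h
    exact hnt (trivialSol_of_forall_integral_eq_zero hf huf hκ h)
  have hFnn : ∀ j, 0 ≤ F j := fun j =>
    setIntegral_nonneg (measurableSet_box n _ _) fun z _ => hf0 _ (abs_nonneg _)
  have hFm : Monotone F := fun i j hij => by
    have h2 : (2 : ℝ) ^ i ≤ 2 ^ j := pow_le_pow_right₀ one_le_two hij
    exact setIntegral_mono_set (huf _ _) (Eventually.of_forall fun z => hf0 _ (abs_nonneg _))
      (box_subset_box n h2 (rpow_le_rpow (by positivity) h2 hκ.le)).eventuallyLE
  have hc₀ : 0 < F j₀ := (hFnn j₀).lt_of_ne' hj₀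
  obtain ⟨c, hc, hcF⟩ := exists_mul_rpow_le_of_le_add_rpow hp hC' hc₀
  set q := min 1 (1 / p) with hq
  have hq0 : 0 < q := lt_min one_pos (by positivity)
  have hqγ : 1 < q * γ := by
    rcases min_choice 1 (1 / p) with h | h
    · rw [hq, h, one_mul]; exact hγ1
    · rw [hq, h, one_div_mul_eq_div, one_lt_div hp]; exact hγp
  set b : ℝ := 2 ^ l with hb
  have hb1 : 1 < b := one_lt_rpow one_lt_two hl
  have hb0 : 0 < b := by linarith
  have hX : ∀ j : ℕ, ((2 : ℝ) ^ j) ^ l = b ^ j := fun j => by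
    rw [hb, ← rpow_natCast, ← rpow_natCast, ← rpow_mul zero_le_two, ← rpow_mul zero_le_two,
      mul_comm]
  have hXγ : ∀ j : ℕ, ((2 : ℝ) ^ j) ^ (n + κ) = (b ^ j) ^ γ := fun j => by
    rw [← hX, ← rpow_mul (by positivity), hlγ]
  have hν : (1 : ℝ) < 2 ^ (n + κ) := one_lt_rpow one_lt_two (by positivity)
  have hν' : (0 : ℝ) < 2 ^ (n + κ) - 1 := sub_pos.2 hν
  set W : ℝ := (2 ^ (n + κ) - 1) * 2 ^ n with hW
  have hW0 : 0 < W := by positivity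
  have hinc : ∀ j, j₀ ≤ j → W * (b ^ j) ^ γ * f (c * F j ^ q / b ^ j) ≤ F (j + 1) - F j := by
    intro j hj
    obtain ⟨h, hh, h₁, h₂⟩ := hstep (2 ^ j) (by positivity)
    rw [hX] at h₁
    rw [hXγ, ← pow_succ'] at h₂
    have hbj : 0 < b ^ j := pow_pos hb0 j
    have h₃ : c * F j ^ q / b ^ j ≤ h := by
      rw [div_le_iff₀' hbj]
      exact hcF _ _ (hFm hj) (by positivity) h₁
    have h₄ : 0 ≤ c * F j ^ q / b ^ j := by
      have := rpow_nonneg (hFnn j) q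
      positivity
    refine le_trans ?_ h₂
    gcongr
    exact hf.1 h₄ hh h₃
  refine hdiv (integrableOn_of_recursion hf.1 hf.continuousOn hf0 (by linarith) hb1 hq0 hqγ
    (c := c / b ^ j₀) (c' := W * (b ^ j₀) ^ γ) (F := fun j => F (j₀ + j))
    (y := fun j => c * F (j₀ + j) ^ q / b ^ (j₀ + j)) (by positivity) (by positivity)
    (fun j => hc₀.trans_le (hFm (by omega))) (fun i j hij => hFm (by omega))
    (fun j => ?_) (fun j => ?_) fun ε hε => ?_)
  · rw [pow_add]
    field_simp
  · have := hinc (j₀ + j) (by omega)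
    rw [pow_add b, mul_rpow (by positivity) (by positivity), ← mul_assoc W, ← pow_add] at this
    exact this
  · by_contra! hge
    have hr0 : 0 < (2 ^ (n + κ) - 1) / (2 : ℝ) ^ (n + κ) := by positivity
    obtain ⟨R₀, hR₀⟩ := exists_forall_integral_lt hk hm hp hf h14 h15 hub hup huf hC henergy hκ
      hr0 ((div_le_one (by positivity)).2 (by linarith)) hε
    obtain ⟨j, hj⟩ := ((tendsto_pow_atTop_atTop_of_one_lt
      (one_lt_two (α := ℝ))).eventually_ge_atTop R₀).exists
    have h2 : (2 : ℝ) ^ j ≤ 2 ^ (j₀ + j + 1) := pow_le_pow_right₀ one_le_two (by omega)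
    have hlt : F (j₀ + j + 1) < _ := hR₀ (2 ^ (j₀ + j + 1)) (hj.trans h2)
    have h₁ := hinc (j₀ + j) (by omega)
    have h₂ : f ε ≤ f (c * F (j₀ + j) ^ q / b ^ (j₀ + j)) :=
      hf.1 hε.le (hε.le.trans (hge j)) (hge j)
    have h₃ : (2 ^ (n + κ) - 1) / (2 : ℝ) ^ (n + κ) *
        ((2 * 2 ^ (j₀ + j + 1)) ^ n * (2 ^ (j₀ + j + 1)) ^ κ) = W * (b ^ (j₀ + j)) ^ γ := by
      have hp2 : (0 : ℝ) < 2 ^ (j₀ + j) := by positivity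
      rw [mul_pow, mul_assoc, ← rpow_natCast (2 ^ (j₀ + j + 1)), ← rpow_add (by positivity),
        pow_succ', mul_rpow zero_le_two hp2.le, hXγ, hW]
      field_simp
    rw [h₃] at hlt
    have h₄ : W * (b ^ (j₀ + j)) ^ γ * f ε ≤
        W * (b ^ (j₀ + j)) ^ γ * f (c * F (j₀ + j) ^ q / b ^ (j₀ + j)) := by gcongr
    linarith [hFnn (j₀ + j)]
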